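/- arXiv:2506.11359 — 2 statements merged into one kernel-verified Lean document; each statement's English description precedes it below -/
import Mathlib

section
/- For each integer m ≥ 3, there does not exist a distinct covering system all of whose moduli lie in the interval [m, 10m]. -/
/-- A covering system: a finite set of congruences `x ≡ a (mod n)`, encoded as pairs
`(a, n) : ℤ × ℕ`, with positive moduli, such that every integer satisfies at least one
of the congruences. -/
def IsCoveringSystem (C : Finset (ℤ × ℕ)) : Prop :=
  (∀ c ∈ C, 0 < c.2) ∧ ∀ x : ℤ, ∃ c ∈ C, x ≡ c.1 [ZMOD (c.2 : ℤ)]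

/-- The moduli of the congruences in `C` are pairwise distinct. -/
def HasDistinctModuli (C : Finset (ℤ × ℕ)) : Prop :=
  ∀ c ∈ C, ∀ c' ∈ C, c ≠ c' → c.2 ≠ c'.2

/-- A distinct covering system: a covering system whose moduli are pairwise distinct
and all greater than `1`. -/
def IsDistinctCoveringSystem (C : Finset (ℤ × ℕ)) : Prop :=
  IsCoveringSystem C ∧ (∀ c ∈ C, 1 < c.2) ∧ HasDistinctModuli C


namespace CovTen

/-- Average of a function over the first `N` naturals. -/
noncomputable def mean (N : ℕ) (f : ℤ → ℝ) : ℝ := (∑ x ∈ Finset.range N, f (x : ℤ)) / N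

/-- Indicator of a residue class. -/
noncomputable def cls (a : ℤ) (n : ℕ) (x : ℤ) : ℝ := if (n : ℤ) ∣ x - a then 1 else 0

lemma cls_nonneg (a : ℤ) (n : ℕ) (x : ℤ) : 0 ≤ cls a n x := by
  unfold cls; split_ifs <;> norm_num

lemma sum_cls_period (a : ℤ) (n : ℕ) (hn : 0 < n) (s : ℤ) :
    ∑ x ∈ Finset.range n, cls a n ((x : ℤ) + s) = 1 := by
  have hn' : (0 : ℤ) < n := by exact_mod_cast hn
  have h0 := Int.emod_nonneg (a - s) hn'.ne'
  have h1 := Int.emod_lt_of_pos (a - s) hn'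
  have hdiv := Int.mul_ediv_add_emod (a - s) n
  rw [Finset.sum_eq_single (((a - s) % n).toNat)]
  · unfold cls
    rw [if_pos]
    rw [Int.toNat_of_nonneg h0]
    exact ⟨-((a - s) / n), by linarith⟩
  · intro b hb hne
    unfold cls
    rw [if_neg]
    intro hd
    apply hne
    have hb' : b < n := Finset.mem_range.1 hb
    have : (n : ℤ) ∣ (b : ℤ) - (a - s) % n := by
      have e : (b : ℤ) - (a - s) % n = (b + s - a) + n * ((a - s) / n) := by linarith
      rw [e]; exact dvd_add hd (dvd_mul_right _ _)
    obtain ⟨k, hk⟩ := this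
    have hk0 : k = 0 := by
      have hb2 : (b : ℤ) < n := by exact_mod_cast hb'
      have hb3 : (0 : ℤ) ≤ b := by positivity
      have : -1 < k := by nlinarith
      have : k < 1 := by nlinarith
      omega
    subst hk0
    omega
  · intro h
    exfalso; apply h
    rw [Finset.mem_range]; omega

lemma sum_cls_mul (a : ℤ) (n : ℕ) (hn : 0 < n) (k : ℕ) :
    ∑ x ∈ Finset.range (n * k), cls a n (x : ℤ) = k := by
  induction k with
  | zero => simp
  | succ k ih =>
    rw [Nat.mul_succ, Finset.sum_range_add, ih]
    have := sum_cls_period a n hn ((n * k : ℕ) : ℤ)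
    push_cast at this ⊢
    rw [← this]
    congr 1
    apply Finset.sum_congr rfl
    intro x _
    rw [add_comm]

lemma mean_cls (N : ℕ) (hN : 0 < N) (a : ℤ) (n : ℕ) (h : n ∣ N) :
    mean N (cls a n) = 1 / n := by
  obtain ⟨k, rfl⟩ := h
  have hn : 0 < n := Nat.pos_of_mul_pos_right hN
  have hk : 0 < k := Nat.pos_of_mul_pos_left hN
  unfold mean
  rw [sum_cls_mul a n hn k]
  have : (n : ℝ) ≠ 0 := by positivity
  have : (k : ℝ) ≠ 0 := by positivity
  push_cast
  field_simp

/-- `C` covers every integer. -/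
def Covers (C : Finset (ℤ × ℕ)) : Prop := ∀ x : ℤ, ∃ c ∈ C, (c.2 : ℤ) ∣ x - c.1

lemma Covers.density {C : Finset (ℤ × ℕ)} (h : Covers C) (hpos : ∀ c ∈ C, 0 < c.2) :
    (1 : ℝ) ≤ ∑ c ∈ C, 1 / (c.2 : ℝ) := by
  set N := ∏ c ∈ C, c.2 with hNdef
  have hN : 0 < N := Finset.prod_pos hpos
  have h1 : ∑ c ∈ C, 1 / (c.2 : ℝ) = ∑ c ∈ C, mean N (cls c.1 c.2) := by
    apply Finset.sum_congr rfl
    intro c hc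
    rw [mean_cls N hN c.1 c.2 (Finset.dvd_prod_of_mem _ hc)]
  rw [h1]
  unfold mean
  rw [← Finset.sum_div, Finset.sum_comm, le_div_iff₀ (by exact_mod_cast hN), one_mul]
  calc (N : ℝ) = ∑ x ∈ Finset.range N, (1 : ℝ) := by simp
    _ ≤ _ := by
      apply Finset.sum_le_sum
      intro x _
      obtain ⟨c, hc, hd⟩ := h x
      calc (1 : ℝ) = cls c.1 c.2 x := by unfold cls; rw [if_pos hd]
        _ ≤ _ := Finset.single_le_sum (f := fun c : ℤ × ℕ => cls c.1 c.2 (x : ℤ))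
                  (fun c _ => cls_nonneg _ _ _) hc

/-- The key fibre lemma. -/
lemma fibre_lemma {C : Finset (ℤ × ℕ)} (h : Covers C) (hpos : ∀ c ∈ C, 0 < c.2)
    {p j : ℕ} (hp : p.Prime) :
    Covers (C.filter (fun c => ¬ p ^ (j + 1) ∣ c.2)) ∨
    (p ≤ (C.filter (fun c => p ^ (j + 1) ∣ c.2)).card ∧
     ((C.filter (fun c => p ^ (j + 1) ∣ c.2)).card < 2 * p →
      (∀ c ∈ C, ¬ p ^ (j + 2) ∣ c.2) →
      ∃ T ⊆ C.filter (fun c => p ^ (j + 1) ∣ c.2),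
        2 * p ≤ T.card + (C.filter (fun c => p ^ (j + 1) ∣ c.2)).card ∧
        ∃ u0 : ℤ, ∀ x : ℤ, (∀ c ∈ C, ¬ p ^ (j + 1) ∣ c.2 → ¬ (c.2 : ℤ) ∣ x - c.1) →
          ∀ c ∈ T, ((c.2 / p : ℕ) : ℤ) ∣ x - u0)) := by
  classical
  by_cases hcov : Covers (C.filter (fun c => ¬ p ^ (j + 1) ∣ c.2))
  · exact Or.inl hcov
  right
  set A := C.filter (fun c => p ^ (j + 1) ∣ c.2) with hA
  set N := ∏ c ∈ C, (c.2 / p ^ c.2.factorization p) with hNdef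
  have hpN : ¬ p ∣ N := by
    rw [hNdef, Prime.dvd_finsetProd_iff hp.prime]
    rintro ⟨c, hc, hd⟩
    exact Nat.not_dvd_ordCompl hp (hpos c hc).ne' hd
  set t : ℕ := p ^ j * N with ht
  have hcop : IsCoprime (p : ℤ) (N : ℤ) :=
    Nat.isCoprime_iff_coprime.2 ((Nat.Prime.coprime_iff_not_dvd hp).2 hpN)
  -- non-multiples divide t
  have hdt : ∀ c ∈ C, ¬ p ^ (j + 1) ∣ c.2 → (c.2 : ℤ) ∣ (t : ℤ) := by
    intro c hc hnd
    have : c.2 ∣ t := by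
      have h1 : c.2 / p ^ c.2.factorization p ∣ N :=
        Finset.dvd_prod_of_mem (fun c : ℤ × ℕ => c.2 / p ^ c.2.factorization p) hc
      have h2 : c.2.factorization p ≤ j := by
        by_contra hlt
        push Not at hlt
        exact hnd ((pow_dvd_pow p hlt).trans (Nat.ordProj_dvd c.2 p))
      calc c.2 = p ^ c.2.factorization p * (c.2 / p ^ c.2.factorization p) :=
            (Nat.ordProj_mul_ordCompl_eq_self c.2 p).symm
        _ ∣ t := mul_dvd_mul (pow_dvd_pow p h2) h1
    exact_mod_cast this
  -- points on a fibre
  have hfib : ∀ x : ℤ, (∀ c ∈ C, ¬ p ^ (j + 1) ∣ c.2 → ¬ (c.2 : ℤ) ∣ x - c.1) →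
      ∀ i : ℤ, ∃ c ∈ A, (c.2 : ℤ) ∣ x + i * t - c.1 := by
    intro x hx i
    obtain ⟨c, hc, hd⟩ := h (x + i * t)
    refine ⟨c, ?_, hd⟩
    rw [hA, Finset.mem_filter]
    refine ⟨hc, ?_⟩
    by_contra hnd
    apply hx c hc hnd
    have : x - c.1 = (x + i * t - c.1) - i * t := by ring
    rw [this]
    exact dvd_sub hd (Dvd.dvd.mul_left (hdt c hc hnd) i)
  have hAq : ∀ c ∈ A, ((p : ℤ) ^ (j + 1)) ∣ (c.2 : ℤ) := by
    intro c hc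
    have := (Finset.mem_filter.1 hc).2
    exact_mod_cast this
  have hpj : ((p : ℤ) ^ j) ≠ 0 := pow_ne_zero _ (by exact_mod_cast hp.ne_zero)
  have hinj : ∀ i i' : ℤ, ((p : ℤ) ^ (j + 1)) ∣ (i - i') * t → (p : ℤ) ∣ i - i' := by
    intro i i' hd
    rw [ht] at hd
    push_cast at hd
    have : (p : ℤ) ^ j * p ∣ (p : ℤ) ^ j * ((i - i') * N) := by
      rw [← pow_succ]; convert hd using 1; ring
    have := (mul_dvd_mul_iff_left hpj).1 this
    exact hcop.dvd_of_dvd_mul_right this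
  -- groups
  let G : ℤ → ℕ → Finset (ℤ × ℕ) := fun x i =>
    A.filter (fun c => ((p : ℤ) ^ (j + 1)) ∣ x + i * t - c.1)
  have hGne : ∀ x : ℤ, (∀ c ∈ C, ¬ p ^ (j + 1) ∣ c.2 → ¬ (c.2 : ℤ) ∣ x - c.1) →
      ∀ i : ℕ, 1 ≤ (G x i).card := by
    intro x hx i
    obtain ⟨c, hc, hd⟩ := hfib x hx i
    exact Finset.card_pos.2 ⟨c, Finset.mem_filter.2 ⟨hc, (hAq c hc).trans hd⟩⟩
  have hGdisj : ∀ x : ℤ, ∀ i ∈ Finset.range p, ∀ i' ∈ Finset.range p, i ≠ i' →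
      Disjoint (G x i) (G x i') := by
    intro x i hi i' hi' hne
    rw [Finset.disjoint_left]
    intro c hc hc'
    have h1 : ((p : ℤ) ^ (j + 1)) ∣ x + i * t - c.1 := (Finset.mem_filter.1 hc).2
    have h2 : ((p : ℤ) ^ (j + 1)) ∣ x + i' * t - c.1 := (Finset.mem_filter.1 hc').2
    have h3 := dvd_sub h1 h2
    have e : x + i * t - c.1 - (x + i' * t - c.1) = ((i : ℤ) - i') * t := by ring
    rw [e] at h3
    have h4 := hinj i i' h3
    obtain ⟨k, hk⟩ := h4
    have hi1 : (i : ℤ) < p := by exact_mod_cast Finset.mem_range.1 hi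
    have hi2 : (i' : ℤ) < p := by exact_mod_cast Finset.mem_range.1 hi'
    have hi3 : (0 : ℤ) ≤ i := by positivity
    have hi4 : (0 : ℤ) ≤ i' := by positivity
    have hk1 : -1 < k := by nlinarith
    have hk2 : k < 1 := by nlinarith
    have hk0 : k = 0 := by omega
    subst hk0
    apply hne; omega
  have hGcard : ∀ x : ℤ, ((Finset.range p).biUnion (G x)).card
      = ∑ i ∈ Finset.range p, (G x i).card := by
    intro x
    exact Finset.card_biUnion (fun i hi i' hi' hne => hGdisj x i hi i' hi' hne)
  have hGsub : ∀ x : ℤ, (Finset.range p).biUnion (G x) ⊆ A := by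
    intro x
    rw [Finset.biUnion_subset]
    intro i _
    exact Finset.filter_subset _ _
  have hGp : ∀ x : ℤ, (∀ c ∈ C, ¬ p ^ (j + 1) ∣ c.2 → ¬ (c.2 : ℤ) ∣ x - c.1) →
      p ≤ ((Finset.range p).biUnion (G x)).card := by
    intro x hx
    rw [hGcard]
    calc p = ∑ i ∈ Finset.range p, 1 := by simp
      _ ≤ _ := Finset.sum_le_sum (fun i _ => hGne x hx i)
  -- an uncovered point
  obtain ⟨u0, hu0⟩ : ∃ u0 : ℤ, ∀ c ∈ C, ¬ p ^ (j + 1) ∣ c.2 → ¬ (c.2 : ℤ) ∣ u0 - c.1 := by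
    unfold Covers at hcov
    push Not at hcov
    obtain ⟨u0, hu⟩ := hcov
    exact ⟨u0, fun c hc hnd => hu c (Finset.mem_filter.2 ⟨hc, hnd⟩)⟩
  refine ⟨(hGp u0 hu0).trans (Finset.card_le_card (hGsub u0)), ?_⟩
  intro hlt hno
  let I := (Finset.range p).filter (fun i => (G u0 i).card = 1)
  refine ⟨I.biUnion (G u0), ?_, ?_, u0, ?_⟩
  · rw [Finset.biUnion_subset]
    intro i _
    exact Finset.filter_subset _ _
  · have h1 : (I.biUnion (G u0)).card = I.card := by
      rw [Finset.card_biUnion]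
      · rw [Finset.card_eq_sum_ones]
        exact Finset.sum_congr rfl (fun i hi => (Finset.mem_filter.1 hi).2)
      · intro i hi i' hi' hne
        exact hGdisj u0 i (Finset.mem_filter.1 hi).1 i' (Finset.mem_filter.1 hi').1 hne
    rw [h1]
    have h2 := Finset.card_le_card (hGsub u0)
    rw [hGcard] at h2
    have h3 : 2 * p ≤ I.card + ∑ i ∈ Finset.range p, (G u0 i).card := by
      rw [Finset.card_filter, ← Finset.sum_add_distrib]
      calc 2 * p = ∑ i ∈ Finset.range p, 2 := by simp [mul_comm]
        _ ≤ _ := by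
          apply Finset.sum_le_sum
          intro i _
          have := hGne u0 hu0 i
          split_ifs <;> omega
    omega
  · intro x hx c hcT
    -- x ≡ u0 mod p^j
    have hmod : ((p : ℤ) ^ j) ∣ x - u0 := by
      by_contra hnd
      have hdis : Disjoint ((Finset.range p).biUnion (G u0)) ((Finset.range p).biUnion (G x)) := by
        rw [Finset.disjoint_left]
        intro c hc hc'
        obtain ⟨i, _, hi⟩ := Finset.mem_biUnion.1 hc
        obtain ⟨i', _, hi'⟩ := Finset.mem_biUnion.1 hc'
        have h1 := (Finset.mem_filter.1 hi).2
        have h2 := (Finset.mem_filter.1 hi').2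
        have h3 := (pow_dvd_pow (p : ℤ) (Nat.le_succ j)).trans (dvd_sub h2 h1)
        apply hnd
        have ht' : ((p : ℤ) ^ j) ∣ (t : ℤ) := by rw [ht]; push_cast; exact dvd_mul_right _ _
        have e : x - u0 = (x + i' * t - c.1 - (u0 + i * t - c.1)) + (i - i') * t := by ring
        rw [e]
        exact dvd_add h3 (Dvd.dvd.mul_left ht' _)
      have h5 := Finset.card_le_card (Finset.union_subset (hGsub u0) (hGsub x))
      rw [Finset.card_union_of_disjoint hdis] at h5
      have := hGp u0 hu0
      have := hGp x hx
      omega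
    obtain ⟨i, hi, hci⟩ := Finset.mem_biUnion.1 hcT
    have hI := (Finset.mem_filter.1 hi).2
    obtain ⟨c', hc'⟩ := Finset.card_eq_one.1 hI
    have hcc : c = c' := by rw [hc'] at hci; exact Finset.mem_singleton.1 hci
    subst hcc
    have huniq : ∀ d ∈ A, ((p : ℤ) ^ (j + 1)) ∣ u0 + i * t - d.1 → d = c := by
      intro d hd hdd
      have : d ∈ G u0 i := Finset.mem_filter.2 ⟨hd, hdd⟩
      rw [hc'] at this
      exact Finset.mem_singleton.1 this
    have hcA : c ∈ A := (Finset.mem_filter.1 hci).1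
    -- c covers u0 + i t
    have hcov0 : (c.2 : ℤ) ∣ u0 + i * t - c.1 := by
      obtain ⟨d, hd, hdd⟩ := hfib u0 hu0 i
      have := huniq d hd ((hAq d hd).trans hdd)
      rwa [this] at hdd
    -- find the index
    obtain ⟨z, hz⟩ := hmod
    obtain ⟨a, b, hab⟩ := hcop
    -- a p + b N = 1
    have hcov1 : (c.2 : ℤ) ∣ x + (i - b * z) * t - c.1 := by
      obtain ⟨d, hd, hdd⟩ := hfib x hx (i - b * z)
      have hq : ((p : ℤ) ^ (j + 1)) ∣ u0 + i * t - d.1 := by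
        have h1 := (hAq d hd).trans hdd
        have e : u0 + i * t - d.1 = (x + (i - b * z) * t - d.1) - (p : ℤ) ^ (j + 1) * (z * a) := by
          have hx' : x = u0 + (p : ℤ) ^ j * z := by linarith
          rw [hx', ht]
          push_cast
          have hb : b * N = 1 - a * p := by linarith
          have : (i - b * z) * ((p : ℤ) ^ j * N) = i * ((p : ℤ) ^ j * N) - z * (p : ℤ) ^ j * (b * N) := by
            ring
          rw [this, hb]
          ring
        rw [e]
        exact dvd_sub h1 (dvd_mul_right _ _)
      have := huniq d hd hq
      rwa [this] at hdd
    have hcC : c ∈ C := (Finset.mem_filter.1 hcA).1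
    have hpc : p ^ (j + 1) ∣ c.2 := (Finset.mem_filter.1 hcA).2
    have hfac : c.2.factorization p = j + 1 := by
      apply le_antisymm
      · by_contra hlt
        push Not at hlt
        exact hno c hcC ((pow_dvd_pow p hlt).trans (Nat.ordProj_dvd c.2 p))
      · exact (hp.pow_dvd_iff_le_factorization (hpos c hcC).ne').1 hpc
    have hdd : c.2 / p ∣ t := by
      have h1 : c.2 / p ^ c.2.factorization p ∣ N :=
        Finset.dvd_prod_of_mem (fun c : ℤ × ℕ => c.2 / p ^ c.2.factorization p) hcC
      have h2 := (Nat.ordProj_mul_ordCompl_eq_self c.2 p).symm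
      rw [hfac] at h1 h2
      have h3 : c.2 / p = p ^ j * (c.2 / p ^ (j + 1)) := by
        apply Nat.div_eq_of_eq_mul_right hp.pos
        rw [← mul_assoc, ← pow_succ']
        exact h2
      rw [h3, ht]
      exact mul_dvd_mul_left _ h1
    have hdn : c.2 / p ∣ c.2 := Nat.div_dvd_of_dvd ((dvd_pow_self p (Nat.succ_ne_zero j)).trans hpc)
    have hdt' : ((c.2 / p : ℕ) : ℤ) ∣ (t : ℤ) := Int.natCast_dvd_natCast.2 hdd
    have hdn' : ((c.2 / p : ℕ) : ℤ) ∣ (c.2 : ℤ) := Int.natCast_dvd_natCast.2 hdn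
    have e : x - u0 = (x + (i - b * z) * t - c.1) - (u0 + i * t - c.1) + (b * z) * t := by ring
    rw [e]
    exact dvd_add (dvd_sub (hdn'.trans hcov1) (hdn'.trans hcov0)) (Dvd.dvd.mul_left hdt' _)

end CovTen

namespace CovTen

/-- There is a covering whose multiset of moduli is contained in `L`. -/
def Cov (L : List ℕ) : Prop :=
  ∃ C : Finset (ℤ × ℕ), Covers C ∧ C.val.map Prod.snd ≤ (L : Multiset ℕ)

lemma mem_of_le {C : Finset (ℤ × ℕ)} {L : List ℕ} (h : C.val.map Prod.snd ≤ (L : Multiset ℕ))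
    {c : ℤ × ℕ} (hc : c ∈ C) : c.2 ∈ L := by
  have : c.2 ∈ C.val.map Prod.snd := Multiset.mem_map_of_mem _ hc
  exact Multiset.mem_coe.1 (Multiset.mem_of_le h this)

lemma filter_map_snd (C : Finset (ℤ × ℕ)) (P : ℕ → Prop) [DecidablePred P] :
    (C.filter (fun c => P c.2)).val.map Prod.snd = (C.val.map Prod.snd).filter P := by
  rw [Multiset.filter_map]; rfl

lemma filter_le {C : Finset (ℤ × ℕ)} {L : List ℕ} (h : C.val.map Prod.snd ≤ (L : Multiset ℕ))
    (P : ℕ → Prop) [DecidablePred P] :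
    (C.filter (fun c => P c.2)).val.map Prod.snd ≤ ((L.filter (fun n => decide (P n)) : List ℕ) : Multiset ℕ) := by
  rw [filter_map_snd, ← Multiset.filter_coe]
  exact Multiset.filter_le_filter _ h

lemma card_le_of_le {C : Finset (ℤ × ℕ)} {L : List ℕ} (h : C.val.map Prod.snd ≤ (L : Multiset ℕ)) :
    C.card ≤ L.length := by
  have := Multiset.card_le_card h
  simpa using this

/-- Sum of reciprocals of a list. -/
noncomputable def rsum (L : List ℕ) : ℝ := (L.map (fun n : ℕ => 1 / (n : ℝ))).sum

lemma rsum_of_le {C : Finset (ℤ × ℕ)} {L : List ℕ} (h : C.val.map Prod.snd ≤ (L : Multiset ℕ)) :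
    ∑ c ∈ C, 1 / (c.2 : ℝ) ≤ rsum L := by
  obtain ⟨s, hs⟩ := Multiset.le_iff_exists_add.1 h
  have h1 : ∑ c ∈ C, 1 / (c.2 : ℝ) = ((C.val.map Prod.snd).map (fun n : ℕ => 1 / (n : ℝ))).sum := by
    rw [Multiset.map_map]; rfl
  have h2 : rsum L = ((L : Multiset ℕ).map (fun n : ℕ => 1 / (n : ℝ))).sum := by
    unfold rsum; simp
  rw [h1, h2, hs, Multiset.map_add, Multiset.sum_add]
  have : 0 ≤ (s.map (fun n : ℕ => 1 / (n : ℝ))).sum := by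
    apply Multiset.sum_nonneg
    intro x hx
    obtain ⟨n, _, rfl⟩ := Multiset.mem_map.1 hx
    positivity
  linarith

lemma Cov.one_le {L : List ℕ} (h : Cov L) (hpos : ∀ n ∈ L, 0 < n) : 1 ≤ rsum L := by
  obtain ⟨C, hC, hle⟩ := h
  exact (hC.density (fun c hc => hpos _ (mem_of_le hle hc))).trans (rsum_of_le hle)

lemma Cov.mono {L : List ℕ} (h : Cov L) (l : ℕ) : Cov (l :: L) := by
  obtain ⟨C, hC, hle⟩ := h
  refine ⟨C, hC, hle.trans ?_⟩
  rw [← Multiset.cons_coe]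
  exact Multiset.le_cons_self _ _

/-- Discarding: fewer than `p` multiples of a power of `p`. -/
lemma Cov.discard {L : List ℕ} (h : Cov L) (hpos : ∀ n ∈ L, 0 < n) {p j : ℕ} (hp : p.Prime)
    (hcount : (L.filter (fun n => decide (p ^ (j + 1) ∣ n))).length < p) :
    Cov (L.filter (fun n => decide (¬ p ^ (j + 1) ∣ n))) := by
  obtain ⟨C, hC, hle⟩ := h
  rcases fibre_lemma hC (fun c hc => hpos _ (mem_of_le hle hc)) (j := j) hp with h1 | ⟨h1, _⟩
  · exact ⟨_, h1, filter_le hle (fun n => ¬ p ^ (j + 1) ∣ n)⟩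
  · have := card_le_of_le (filter_le hle (fun n => p ^ (j + 1) ∣ n))
    omega

lemma insert_le (C : Finset (ℤ × ℕ)) (a : ℤ × ℕ) {L : List ℕ}
    (h : C.val.map Prod.snd ≤ (L : Multiset ℕ)) :
    (insert a C).val.map Prod.snd ≤ ((a.2 :: L : List ℕ) : Multiset ℕ) := by
  rw [← Multiset.cons_coe]
  by_cases ha : a ∈ C
  · rw [Finset.insert_eq_of_mem ha]
    exact h.trans (Multiset.le_cons_self _ _)
  · rw [Finset.insert_val_of_notMem ha, Multiset.map_cons]
    exact Multiset.cons_le_cons _ h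

lemma Cov.two_p {L : List ℕ} (h : Cov L) (hpos : ∀ n ∈ L, 0 < n) {p j : ℕ} (hp : p.Prime)
    (hcount : (L.filter (fun n => decide (p ^ (j + 1) ∣ n))).length < 2 * p)
    (hno : ∀ n ∈ L, ¬ p ^ (j + 2) ∣ n) :
    Cov (L.filter (fun n => decide (¬ p ^ (j + 1) ∣ n))) ∨
    ∃ T : Multiset ℕ, T ≤ ((L.filter (fun n => decide (p ^ (j + 1) ∣ n)) : List ℕ) : Multiset ℕ) ∧
      2 * p ≤ Multiset.card T + (L.filter (fun n => decide (p ^ (j + 1) ∣ n))).length ∧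
      ∀ l : ℕ, l ∣ (T.map (fun n => n / p)).lcm →
        Cov (l :: L.filter (fun n => decide (¬ p ^ (j + 1) ∣ n))) := by
  obtain ⟨C, hC, hle⟩ := h
  have hposC : ∀ c ∈ C, 0 < c.2 := fun c hc => hpos _ (mem_of_le hle hc)
  have hleA := filter_le hle (fun n => p ^ (j + 1) ∣ n)
  have hleB := filter_le hle (fun n => ¬ p ^ (j + 1) ∣ n)
  have hcA := card_le_of_le hleA
  rcases fibre_lemma hC hposC (j := j) hp with h1 | ⟨_, h1⟩
  · exact Or.inl ⟨_, h1, hleB⟩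
  right
  obtain ⟨T, hT, hcard, u0, hu⟩ := h1 (by omega) (fun c hc => hno _ (mem_of_le hle hc))
  refine ⟨T.val.map Prod.snd, ?_, ?_, ?_⟩
  · exact (Multiset.map_le_map (Finset.val_le_iff.2 hT)).trans hleA
  · rw [Multiset.card_map]
    have : T.card = Multiset.card T.val := rfl
    omega
  · intro l hl
    refine ⟨insert (u0, l) (C.filter (fun c => ¬ p ^ (j + 1) ∣ c.2)), ?_, insert_le _ _ hleB⟩
    intro x
    by_cases hx : ∀ c ∈ C, ¬ p ^ (j + 1) ∣ c.2 → ¬ (c.2 : ℤ) ∣ x - c.1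
    · refine ⟨(u0, l), Finset.mem_insert_self _ _, ?_⟩
      have h2 := hu x hx
      have h3 : ((T.val.map Prod.snd).map (fun n => n / p)).lcm ∣ (x - u0).natAbs := by
        rw [Multiset.lcm_dvd]
        intro b hb
        rw [Multiset.map_map] at hb
        obtain ⟨c, hc, rfl⟩ := Multiset.mem_map.1 hb
        exact Int.natCast_dvd.1 (h2 c hc)
      exact Int.natCast_dvd.2 (hl.trans h3)
    · push Not at hx
      obtain ⟨c, hc, hnd, hd⟩ := hx
      exact ⟨c, Finset.mem_insert_of_mem (Finset.mem_filter.2 ⟨hc, hnd⟩), hd⟩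

/-- Final step: if fewer than `2p` multiples of `p^(j+1)` remain. -/
lemma Cov.final {L : List ℕ} (h : Cov L) (hpos : ∀ n ∈ L, 0 < n) {p j B : ℕ} (hp : p.Prime)
    (hB : 0 < B)
    (hcount : (L.filter (fun n => decide (p ^ (j + 1) ∣ n))).length < 2 * p)
    (hno : ∀ n ∈ L, ¬ p ^ (j + 2) ∣ n)
    (hv : ∀ v : ℕ, v < B → 0 < v →
      ((L.filter (fun n => decide (p ^ (j + 1) ∣ n))).filter (fun n => decide (n / p ∣ v))).length
        + (L.filter (fun n => decide (p ^ (j + 1) ∣ n))).length < 2 * p) :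
    1 ≤ rsum (L.filter (fun n => decide (¬ p ^ (j + 1) ∣ n))) + 1 / B := by
  have hB' : (0 : ℝ) ≤ 1 / B := by positivity
  have hpos' : ∀ n ∈ L.filter (fun n => decide (¬ p ^ (j + 1) ∣ n)), 0 < n :=
    fun n hn => hpos n (List.mem_of_mem_filter hn)
  rcases h.two_p hpos hp hcount hno with h1 | ⟨T, hT, hcard, h1⟩
  · have := h1.one_le hpos'
    linarith
  · have hTpos : ∀ n ∈ T, 0 < n / p := by
      intro n hn
      have h2 := Multiset.mem_coe.1 (Multiset.mem_of_le hT hn)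
      have h3 := List.mem_filter.1 h2
      have h4 : p ^ (j + 1) ∣ n := by simpa using h3.2
      exact Nat.div_pos (Nat.le_of_dvd (hpos n h3.1) ((dvd_pow_self p (Nat.succ_ne_zero j)).trans h4)) hp.pos
    set l := (T.map (fun n => n / p)).lcm with hl
    have hl0 : 0 < l := by
      rw [Nat.pos_iff_ne_zero, hl, Ne, Multiset.lcm_eq_zero_iff]
      intro h0
      obtain ⟨n, hn, h5⟩ := Multiset.mem_map.1 h0
      have := hTpos n hn
      omega
    have hlB : B ≤ l := by
      by_contra hlt
      push Not at hlt
      have h6 := hv l hlt hl0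
      have h7 : T ≤ (((L.filter (fun n => decide (p ^ (j + 1) ∣ n))).filter
          (fun n => decide (n / p ∣ l)) : List ℕ) : Multiset ℕ) := by
        rw [← Multiset.filter_coe, Multiset.le_filter]
        refine ⟨hT, fun n hn => ?_⟩
        exact Multiset.dvd_lcm (Multiset.mem_map_of_mem (fun n => n / p) hn)
      have h8 := Multiset.card_le_card h7
      rw [Multiset.coe_card] at h8
      omega
    have h9 := (h1 l (dvd_refl _)).one_le (by
      intro n hn
      rcases List.mem_cons.1 hn with rfl | hn
      · exact hl0
      · exact hpos' n hn)
    have h10 : rsum (l :: L.filter (fun n => decide (¬ p ^ (j + 1) ∣ n)))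
        = 1 / (l : ℝ) + rsum (L.filter (fun n => decide (¬ p ^ (j + 1) ∣ n))) := by
      unfold rsum; simp
    have h11 : (1 : ℝ) / l ≤ 1 / B :=
      one_div_le_one_div_of_le (by exact_mod_cast hB) (by exact_mod_cast hlB)
    linarith

/-- Chain step: at most `p` multiples of `p^(j+1)` remain. -/
lemma Cov.chain {L : List ℕ} (h : Cov L) (hpos : ∀ n ∈ L, 0 < n) {p j l : ℕ} (hp : p.Prime)
    (hcount : (L.filter (fun n => decide (p ^ (j + 1) ∣ n))).length ≤ p)
    (hno : ∀ n ∈ L, ¬ p ^ (j + 2) ∣ n)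
    (hl : l ∣ ((L.filter (fun n => decide (p ^ (j + 1) ∣ n))).map (fun n => n / p)).foldr Nat.lcm 1) :
    Cov (l :: L.filter (fun n => decide (¬ p ^ (j + 1) ∣ n))) := by
  have hp0 := hp.pos
  rcases h.two_p hpos hp (by omega) hno with h1 | ⟨T, hT, hcard, h1⟩
  · exact h1.mono l
  · have hTeq : T = ((L.filter (fun n => decide (p ^ (j + 1) ∣ n)) : List ℕ) : Multiset ℕ) := by
      apply Multiset.eq_of_le_of_card_le hT
      rw [Multiset.coe_card]
      omega
    apply h1
    rw [hTeq]
    exact hl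

/-- Strict density when two moduli are coprime. -/
lemma Covers.density_strict {C : Finset (ℤ × ℕ)} (h : Covers C) (hpos : ∀ c ∈ C, 0 < c.2)
    {c d : ℤ × ℕ} (hc : c ∈ C) (hd : d ∈ C) (hcd : c ≠ d) (hcop : Nat.Coprime c.2 d.2) :
    (1 : ℝ) < ∑ c ∈ C, 1 / (c.2 : ℝ) := by
  set N := ∏ c ∈ C, c.2 with hNdef
  have hN : 0 < N := Finset.prod_pos hpos
  have h1 : ∑ c ∈ C, 1 / (c.2 : ℝ) = ∑ c ∈ C, mean N (cls c.1 c.2) := by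
    apply Finset.sum_congr rfl
    intro c hc
    rw [mean_cls N hN c.1 c.2 (Finset.dvd_prod_of_mem _ hc)]
  -- a point covered twice
  obtain ⟨x0, hx0, hx1, hx2⟩ : ∃ x0 ∈ Finset.range N, (c.2 : ℤ) ∣ (x0 : ℤ) - c.1 ∧
      (d.2 : ℤ) ∣ (x0 : ℤ) - d.1 := by
    obtain ⟨a, b, hab⟩ := Nat.isCoprime_iff_coprime.2 hcop
    let z : ℤ := c.1 + a * c.2 * (d.1 - c.1)
    have hN' : (0 : ℤ) < N := by exact_mod_cast hN
    have hz0 := Int.emod_nonneg z hN'.ne'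
    have hz1 := Int.emod_lt_of_pos z hN'
    have hzd := Int.mul_ediv_add_emod z N
    have hcN : (c.2 : ℤ) ∣ N := Int.natCast_dvd_natCast.2 (Finset.dvd_prod_of_mem (fun c : ℤ × ℕ => c.2) hc)
    have hdN : (d.2 : ℤ) ∣ N := Int.natCast_dvd_natCast.2 (Finset.dvd_prod_of_mem (fun c : ℤ × ℕ => c.2) hd)
    refine ⟨(z % N).toNat, ?_, ?_, ?_⟩
    · rw [Finset.mem_range]; omega
    · rw [Int.toNat_of_nonneg hz0]
      have e : z % N - c.1 = c.2 * (a * (d.1 - c.1)) - N * (z / N) := by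
        have : z = c.1 + a * c.2 * (d.1 - c.1) := rfl
        linear_combination hzd + this
      rw [e]
      exact dvd_sub (dvd_mul_right _ _) (Dvd.dvd.mul_right hcN _)
    · rw [Int.toNat_of_nonneg hz0]
      have e : z % N - d.1 = d.2 * (b * (c.1 - d.1)) - N * (z / N) := by
        have : z = c.1 + a * c.2 * (d.1 - c.1) := rfl
        linear_combination hzd + this + (d.1 - c.1) * hab
      rw [e]
      exact dvd_sub (dvd_mul_right _ _) (Dvd.dvd.mul_right hdN _)
  rw [h1]
  unfold mean
  rw [← Finset.sum_div, Finset.sum_comm, lt_div_iff₀ (by exact_mod_cast hN), one_mul]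
  calc (N : ℝ) = ∑ x ∈ Finset.range N, (1 : ℝ) := by simp
    _ < _ := by
      apply Finset.sum_lt_sum
      · intro x _
        obtain ⟨c, hc, hd⟩ := h x
        calc (1 : ℝ) = cls c.1 c.2 x := by unfold cls; rw [if_pos hd]
          _ ≤ _ := Finset.single_le_sum (f := fun c : ℤ × ℕ => cls c.1 c.2 (x : ℤ))
                    (fun c _ => cls_nonneg _ _ _) hc
      · refine ⟨x0, hx0, ?_⟩
        calc (1 : ℝ) < cls c.1 c.2 x0 + cls d.1 d.2 x0 := by
              unfold cls; rw [if_pos hx1, if_pos hx2]; norm_num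
          _ = ∑ e ∈ ({c, d} : Finset (ℤ × ℕ)), cls e.1 e.2 x0 := by rw [Finset.sum_pair hcd]
          _ ≤ _ := by
            apply Finset.sum_le_sum_of_subset_of_nonneg
            · intro e he
              rcases Finset.mem_insert.1 he with rfl | he
              · exact hc
              · rw [Finset.mem_singleton.1 he]; exact hd
            · intro e _ _
              exact cls_nonneg _ _ _

/-- After discarding, all moduli satisfy a smoothness condition. -/
lemma exists_reduced {C : Finset (ℤ × ℕ)} (h : Covers C) {m : ℕ} (hm : 0 < m)
    (hrange : ∀ c ∈ C, m ≤ c.2 ∧ c.2 ≤ 10 * m)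
    (hdist : ∀ c ∈ C, ∀ c' ∈ C, c ≠ c' → c.2 ≠ c'.2) :
    ∃ C' ⊆ C, Covers C' ∧ ∀ c ∈ C', ∀ p j : ℕ, p.Prime → p ^ (j + 1) ∣ c.2 →
      p ^ (j + 1) * (p - 1) ≤ 9 * m := by
  classical
  obtain ⟨C', hC'⟩ := Finset.exists_minimal (s := C.powerset.filter (fun D => Covers D))
    ⟨C, Finset.mem_filter.2 ⟨Finset.mem_powerset_self C, h⟩⟩
  have hmem := Finset.mem_filter.1 hC'.prop
  have hsub : C' ⊆ C := Finset.mem_powerset.1 hmem.1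
  refine ⟨C', hsub, hmem.2, ?_⟩
  intro c hc p j hp hd
  have hpos : ∀ c ∈ C', 0 < c.2 := fun c hc => lt_of_lt_of_le hm (hrange c (hsub hc)).1
  rcases fibre_lemma hmem.2 hpos (j := j) hp with h1 | ⟨h1, _⟩
  · exfalso
    have h2 := hC'.le_of_le (y := C'.filter (fun c => ¬ p ^ (j + 1) ∣ c.2))
      (Finset.mem_filter.2 ⟨Finset.mem_powerset.2 ((Finset.filter_subset _ _).trans hsub), h1⟩)
      (Finset.filter_subset _ _)
    exact (Finset.mem_filter.1 (h2 hc)).2 hd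
  · set q := p ^ (j + 1) with hq
    have hq0 : 0 < q := pow_pos hp.pos _
    -- count multiples of q in [m, 10m]
    have hcard : (C'.filter (fun c => q ∣ c.2)).card ≤ 9 * m / q + 1 := by
      have h3 : (C'.filter (fun c => q ∣ c.2)).card
          ≤ (Finset.Icc ((m + q - 1) / q) (10 * m / q)).card := by
        apply Finset.card_le_card_of_injOn (fun c => c.2 / q)
        · intro c hc
          have hc' := Finset.mem_filter.1 hc
          obtain ⟨k, hk⟩ := hc'.2
          have hr := hrange c (hsub hc'.1)
          show c.2 / q ∈ _
          rw [hk, Nat.mul_div_cancel_left k hq0, Finset.mem_coe, Finset.mem_Icc]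
          constructor
          · rw [Nat.div_le_iff_le_mul_add_pred hq0]
            have := hr.1
            rw [hk] at this
            omega
          · rw [Nat.le_div_iff_mul_le hq0, mul_comm, ← hk]
            exact hr.2
        · intro c hc d hd he
          have hc' := Finset.mem_filter.1 hc
          have hd' := Finset.mem_filter.1 hd
          by_contra hne
          apply hdist c (hsub hc'.1) d (hsub hd'.1) hne
          have he' : c.2 / q = d.2 / q := he
          rw [← Nat.div_mul_cancel hc'.2, ← Nat.div_mul_cancel hd'.2, he']
      rw [Nat.card_Icc] at h3
      refine h3.trans ?_
      have h4 : m ≤ q * ((m + q - 1) / q) := by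
        have := Nat.div_add_mod (m + q - 1) q
        have := Nat.mod_lt (m + q - 1) hq0
        omega
      rcases Nat.le_total ((m + q - 1) / q) (10 * m / q) with h5 | h5
      · have h6 : 10 * m / q - (m + q - 1) / q ≤ 9 * m / q := by
          rw [Nat.le_div_iff_mul_le hq0, Nat.sub_mul]
          have := Nat.div_mul_le_self (10 * m) q
          rw [mul_comm q] at h4
          omega
        rw [Nat.sub_add_comm h5]
        exact Nat.add_le_add_right h6 1
      · calc 10 * m / q + 1 - (m + q - 1) / q ≤ 1 := by
              rw [Nat.sub_le_iff_le_add, add_comm 1]; exact Nat.add_le_add_right h5 1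
          _ ≤ _ := Nat.le_add_left 1 _
    have h7 : p - 1 ≤ 9 * m / q := Nat.sub_le_iff_le_add.2 (h1.trans hcard)
    rw [Nat.le_div_iff_mul_le hq0] at h7
    rw [mul_comm]; exact h7

end CovTen

namespace CovTen

/-- Check that `L` is divisible by all prime powers that can occur. -/
def chkL (b L R : ℕ) : Bool :=
  Nat.ble (9 * b + 1) (R * (R - 1)) && Nat.ble (9 * b + 1) (2 ^ 19) &&
  (List.range R).all (fun x => Nat.ble x 1 || (List.range 18).all (fun j =>
    cond (Nat.ble (x ^ (j + 1) * (x - 1)) (9 * b)) (Nat.beq (L % x ^ (j + 1)) 0) true))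

lemma chkL_spec {b L R : ℕ} (h : chkL b L R = true) {n : ℕ}
    (hn : ∀ p j : ℕ, p.Prime → p ^ (j + 1) ∣ n → p ^ (j + 1) * (p - 1) ≤ 9 * b) : n ∣ L := by
  unfold chkL at h
  simp only [Bool.and_eq_true, Bool.or_eq_true, Nat.ble_eq, List.all_eq_true, List.mem_range] at h
  obtain ⟨⟨hR, h19⟩, hall⟩ := h
  rw [Nat.dvd_iff_prime_pow_dvd_dvd]
  intro p k hp hpk
  rcases k with _ | j
  · simp
  have h1 := hn p j hp hpk
  have hp2 := hp.two_le
  have hpR : p < R := by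
    by_contra hcon
    push Not at hcon
    have h2 : R * (R - 1) ≤ p ^ (j + 1) * (p - 1) := by
      apply Nat.mul_le_mul
      · calc R ≤ p ^ 1 := by simpa using hcon
          _ ≤ p ^ (j + 1) := Nat.pow_le_pow_right hp.pos (by omega)
      · omega
    omega
  have hj : j < 18 := by
    by_contra hcon
    push Not at hcon
    have h2 : 2 ^ 19 ≤ p ^ (j + 1) * (p - 1) := by
      calc 2 ^ 19 ≤ 2 ^ (j + 1) := Nat.pow_le_pow_right (by norm_num) (by omega)
        _ ≤ p ^ (j + 1) := Nat.pow_le_pow_left hp2 _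
        _ ≤ p ^ (j + 1) * (p - 1) := Nat.le_mul_of_pos_right _ (by omega)
    omega
  have := (hall p hpR).resolve_left (by omega) j hj
  have hb : Nat.ble (p ^ (j + 1) * (p - 1)) (9 * b) = true := by simpa using h1
  rw [hb] at this
  simp only [cond_true] at this
  exact Nat.dvd_of_mod_eq_zero (Nat.eq_of_beq_eq_true this)

/-- Upper bound, in units of `10 ^ (-9)`, for the sum of `1/n` over divisors `n ≤ hi` of `L`
in a dyadic interval. -/
def sumDiv (L hi : ℕ) : ℕ → ℕ → ℕ
  | 0, a => cond (Nat.ble a hi) (cond (Nat.beq (L % a) 0) (1000000000 / a + 1) 0) 0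
  | k + 1, a => cond (Nat.ble a hi) (sumDiv L hi k a + sumDiv L hi k (a + 2 ^ k)) 0

lemma inv_le_fix {n : ℕ} (hn : 0 < n) :
    1 / (n : ℝ) ≤ ((1000000000 / n + 1 : ℕ) : ℝ) / 1000000000 := by
  have h : 1000000000 < n * (1000000000 / n + 1) := Nat.lt_mul_div_succ _ hn
  have h' : (1000000000 : ℝ) < n * ((1000000000 / n + 1 : ℕ) : ℝ) := by exact_mod_cast h
  rw [div_le_div_iff₀ (by positivity) (by norm_num)]
  linarith

lemma sumDiv_spec (L hi : ℕ) (k a : ℕ) (ha : 0 < a) :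
    ∑ n ∈ Finset.Ico a (a + 2 ^ k), (if n ≤ hi ∧ n ∣ L then 1 / (n : ℝ) else 0) ≤
      (sumDiv L hi k a : ℝ) / 1000000000 := by
  induction k generalizing a with
  | zero =>
    simp only [pow_zero, Nat.Ico_succ_singleton, Finset.sum_singleton]
    split_ifs with h
    · have h1 : Nat.ble a hi = true := by simpa using h.1
      have h2 : Nat.beq (L % a) 0 = true := by simp [Nat.mod_eq_zero_of_dvd h.2]
      unfold sumDiv
      rw [h1, h2]
      exact inv_le_fix ha
    · positivity
  | succ k ih =>
    by_cases h : a ≤ hi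
    · have h1 : Nat.ble a hi = true := by simpa using h
      unfold sumDiv
      rw [h1]
      have := ih a ha
      have := ih (a + 2 ^ k) (by positivity)
      simp only [cond_true]
      rw [← Finset.sum_Ico_consecutive _ (Nat.le_add_right a (2 ^ k))
        (by rw [pow_succ]; omega)]
      push_cast
      rw [add_div]
      have e : a + 2 ^ (k + 1) = a + 2 ^ k + 2 ^ k := by rw [pow_succ]; omega
      rw [e]
      linarith
    · rw [Finset.sum_eq_zero]
      · positivity
      · intro n hn
        rw [if_neg]
        have := (Finset.mem_Ico.1 hn).1
        omega

/-- Check for a block of values of `m`. -/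
def chkBlock (a b L R k : ℕ) : Bool :=
  chkL b L R && Nat.ble 1 a && Nat.ble (10 * b + 1) (a + 2 ^ k) &&
    Nat.ble (sumDiv L (10 * b) k a + 1) 1000000000

lemma block {a b L R k : ℕ} (hchk : chkBlock a b L R k = true) {m : ℕ} (ham : a ≤ m) (hmb : m ≤ b)
    {C : Finset (ℤ × ℕ)} (h : Covers C)
    (hrange : ∀ c ∈ C, m ≤ c.2 ∧ c.2 ≤ 10 * m)
    (hdist : ∀ c ∈ C, ∀ c' ∈ C, c ≠ c' → c.2 ≠ c'.2) : False := by
  unfold chkBlock at hchk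
  simp only [Bool.and_eq_true, Nat.ble_eq] at hchk
  obtain ⟨⟨⟨hL, ha⟩, hk⟩, hs⟩ := hchk
  obtain ⟨C', hC', hcov, hred⟩ := exists_reduced h (by omega) hrange hdist
  have hdvd : ∀ c ∈ C', c.2 ∣ L := by
    intro c hc
    apply chkL_spec hL
    intro p j hp hd
    have := hred c hc p j hp hd
    omega
  have h1 := hcov.density (fun c hc => by have := (hrange c (hC' hc)).1; omega)
  have h2 := sumDiv_spec L (10 * b) k a (by omega)
  have hinj : Set.InjOn Prod.snd (C' : Set (ℤ × ℕ)) := by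
    intro c hc d hd he
    by_contra hne
    exact hdist c (hC' hc) d (hC' hd) hne he
  have h3 : ∑ c ∈ C', 1 / (c.2 : ℝ) ≤
      ∑ n ∈ Finset.Ico a (a + 2 ^ k), (if n ≤ 10 * b ∧ n ∣ L then 1 / (n : ℝ) else 0) := by
    rw [← Finset.sum_image (f := fun n : ℕ => 1 / (n : ℝ)) hinj, ← Finset.sum_filter]
    apply Finset.sum_le_sum_of_subset_of_nonneg
    · intro n hn
      obtain ⟨c, hc, rfl⟩ := Finset.mem_image.1 hn
      have := hrange c (hC' hc)
      rw [Finset.mem_filter, Finset.mem_Ico]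
      exact ⟨⟨by omega, by omega⟩, by omega, hdvd c hc⟩
    · intros; positivity
  have h4 : ((sumDiv L (10 * b) k a + 1 : ℕ) : ℝ) ≤ ((1000000000 : ℕ) : ℝ) := by exact_mod_cast hs
  push_cast at h4
  rw [le_div_iff₀ (by norm_num)] at h2
  nlinarith

end CovTen

namespace CovTen

lemma blk67 : chkBlock 67 67
    809559406656000
    26 10 = true := by decide +kernel

lemma blk68 : chkBlock 68 68
    809559406656000
    26 10 = true := by decide +kernel

lemma blk69 : chkBlock 69 71
    809559406656000
    26 10 = true := by decide +kernel

lemma blk72 : chkBlock 72 81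
    809559406656000
    28 10 = true := by decide +kernel

lemma blk82 : chkBlock 82 90
    809559406656000
    29 10 = true := by decide +kernel

lemma blk91 : chkBlock 91 103
    23477222793024000
    31 10 = true := by decide +kernel

lemma blk104 : chkBlock 104 112
    727793906583744000
    33 10 = true := by decide +kernel

lemma blk113 : chkBlock 113 134
    1455587813167488000
    36 11 = true := by decide +kernel

lemma blk135 : chkBlock 135 153
    592424239959167616000
    38 11 = true := by decide +kernel

lemma blk154 : chkBlock 154 182
    1777272719877502848000
    41 11 = true := by decide +kernel

lemma blk183 : chkBlock 183 200
    72868181514977616768000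
    43 11 = true := by decide +kernel

lemma blk201 : chkBlock 201 235
    570266388536214828826368000
    47 12 = true := by decide +kernel

lemma blk236 : chkBlock 236 278
    134012601306010484774196480000
    51 12 = true := by decide +kernel

lemma blk279 : chkBlock 279 343
    7102667869218555693032413440000
    57 12 = true := by decide +kernel

lemma blk344 : chkBlock 344 406
    419057404283894785888912392960000
    61 12 = true := by decide +kernel

lemma blk407 : chkBlock 407 509
    10276125667849667939567909700165120000
    69 13 = true := by decide +kernel

lemma blk510 : chkBlock 510 619
    905439708719902091823268091591248888320000
    76 13 = true := by decide +kernel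

lemma blk620 : chkBlock 620 756
    1359065002788573039826725405478464581368320000
    83 13 = true := by decide +kernel

lemma blk757 : chkBlock 757 1034
    20078826351198378090400041140538835725135559680000
    97 14 = true := by decide +kernel

lemma blk1035 : chkBlock 1035 1307
    49863214248392078584770494937701334204834119717558215680000
    109 14 = true := by decide +kernel

lemma blk1308 : chkBlock 1308 1777
    709360817431549242877554005000555770078087839708145046622796800000
    127 15 = true := by decide +kernel

lemma blk1778 : chkBlock 1778 2450
    449477105634216367531469739759764066363811467466000846531308932191897600000
    149 15 = true := by decide +kernel

lemma blk2451 : chkBlock 2451 3346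
    87382339193996826460867623713929290509457742000209876127207212665887864515923104930252800000
    175 15 = true := by decide +kernel

lemma blk3347 : chkBlock 3347 4581
    24548021868236649627163418159460303313764764131988436890810829649529543068250879736155377173801817804800000
    204 16 = true := by decide +kernel

lemma mid_range {m : ℕ} (h67 : 67 ≤ m) (hm : m ≤ 4581) {C : Finset (ℤ × ℕ)} (h : Covers C)
    (hrange : ∀ c ∈ C, m ≤ c.2 ∧ c.2 ≤ 10 * m)
    (hdist : ∀ c ∈ C, ∀ c' ∈ C, c ≠ c' → c.2 ≠ c'.2) : False := by
  by_cases h67 : m ≤ 67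
  · exact block blk67 (by omega) h67 h hrange hdist
  by_cases h68 : m ≤ 68
  · exact block blk68 (by omega) h68 h hrange hdist
  by_cases h71 : m ≤ 71
  · exact block blk69 (by omega) h71 h hrange hdist
  by_cases h81 : m ≤ 81
  · exact block blk72 (by omega) h81 h hrange hdist
  by_cases h90 : m ≤ 90
  · exact block blk82 (by omega) h90 h hrange hdist
  by_cases h103 : m ≤ 103
  · exact block blk91 (by omega) h103 h hrange hdist
  by_cases h112 : m ≤ 112
  · exact block blk104 (by omega) h112 h hrange hdist
  by_cases h134 : m ≤ 134
  · exact block blk113 (by omega) h134 h hrange hdist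
  by_cases h153 : m ≤ 153
  · exact block blk135 (by omega) h153 h hrange hdist
  by_cases h182 : m ≤ 182
  · exact block blk154 (by omega) h182 h hrange hdist
  by_cases h200 : m ≤ 200
  · exact block blk183 (by omega) h200 h hrange hdist
  by_cases h235 : m ≤ 235
  · exact block blk201 (by omega) h235 h hrange hdist
  by_cases h278 : m ≤ 278
  · exact block blk236 (by omega) h278 h hrange hdist
  by_cases h343 : m ≤ 343
  · exact block blk279 (by omega) h343 h hrange hdist
  by_cases h406 : m ≤ 406
  · exact block blk344 (by omega) h406 h hrange hdist
  by_cases h509 : m ≤ 509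
  · exact block blk407 (by omega) h509 h hrange hdist
  by_cases h619 : m ≤ 619
  · exact block blk510 (by omega) h619 h hrange hdist
  by_cases h756 : m ≤ 756
  · exact block blk620 (by omega) h756 h hrange hdist
  by_cases h1034 : m ≤ 1034
  · exact block blk757 (by omega) h1034 h hrange hdist
  by_cases h1307 : m ≤ 1307
  · exact block blk1035 (by omega) h1307 h hrange hdist
  by_cases h1777 : m ≤ 1777
  · exact block blk1308 (by omega) h1777 h hrange hdist
  by_cases h2450 : m ≤ 2450
  · exact block blk1778 (by omega) h2450 h hrange hdist
  by_cases h3346 : m ≤ 3346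
  · exact block blk2451 (by omega) h3346 h hrange hdist
  exact block blk3347 (by omega) hm h hrange hdist

end CovTen

namespace CovTen

/-- Certificates for small values of `m`. -/
inductive Cert where
  | done : Cert
  | disc : ℕ → ℕ → Cert → Cert
  | chain : ℕ → ℕ → ℕ → Cert → Cert
  | fin : ℕ → ℕ → Cert
  | three : Cert

def fixsum : List ℕ → ℕ
  | [] => 0
  | n :: L => 1000000000 / n + 1 + fixsum L

lemma fixsum_spec (L : List ℕ) (hpos : ∀ n ∈ L, 0 < n) :
    rsum L ≤ (fixsum L : ℝ) / 1000000000 := by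
  induction L with
  | nil => simp [rsum, fixsum]
  | cons n L ih =>
    have h1 := ih (fun k hk => hpos k (List.mem_cons_of_mem _ hk))
    have h2 := inv_le_fix (hpos n List.mem_cons_self)
    have e : rsum (n :: L) = 1 / (n : ℝ) + rsum L := by simp [rsum]
    have e2 : fixsum (n :: L) = 1000000000 / n + 1 + fixsum L := rfl
    rw [e, e2, Nat.cast_add, add_div]
    linarith

def smallPrime (p : ℕ) : Bool := [2, 3, 5, 7, 11, 13, 17, 19, 23].any (fun q => Nat.beq p q)

lemma smallPrime_spec {p : ℕ} (h : smallPrime p = true) : p.Prime := by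
  unfold smallPrime at h
  simp only [List.any_cons, List.any_nil, Bool.or_eq_true, Nat.beq_eq] at h
  rcases h with h | h | h | h | h | h | h | h | h | h
  all_goals first | (subst h; norm_num) | simp at h

def chkCert : Cert → List ℕ → Bool
  | Cert.done, D => Nat.ble (fixsum D + 1) 1000000000
  | Cert.disc p j c, D => smallPrime p &&
      Nat.ble ((D.filter (fun n => decide (p ^ (j + 1) ∣ n))).length + 1) p &&
      chkCert c (D.filter (fun n => decide (¬ p ^ (j + 1) ∣ n)))
  | Cert.chain p j l c, D => smallPrime p &&
      Nat.ble ((D.filter (fun n => decide (p ^ (j + 1) ∣ n))).length) p &&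
      D.all (fun n => decide (¬ p ^ (j + 2) ∣ n)) &&
      decide (l ∣ ((D.filter (fun n => decide (p ^ (j + 1) ∣ n))).map (fun n => n / p)).foldr
        Nat.lcm 1) && Nat.ble 1 l &&
      chkCert c (l :: D.filter (fun n => decide (¬ p ^ (j + 1) ∣ n)))
  | Cert.fin p B, D => smallPrime p && Nat.ble 1 B &&
      Nat.ble ((D.filter (fun n => decide (p ^ (0 + 1) ∣ n))).length + 1) (2 * p) &&
      D.all (fun n => decide (¬ p ^ (0 + 2) ∣ n)) &&
      (List.range B).all (fun v => Nat.beq v 0 ||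
        Nat.ble (((D.filter (fun n => decide (p ^ (0 + 1) ∣ n))).filter
            (fun n => decide (n / p ∣ v))).length
          + (D.filter (fun n => decide (p ^ (0 + 1) ∣ n))).length + 1) (2 * p)) &&
      Nat.ble (fixsum (D.filter (fun n => decide (¬ p ^ (0 + 1) ∣ n))) + (1000000000 / B + 1) + 1)
        1000000000
  | Cert.three, D => decide (D = [12, 12, 3, 4, 6, 12])

lemma three_false (h : Cov [12, 12, 3, 4, 6, 12]) : False := by
  obtain ⟨C, hC, hle⟩ := h
  have hpos : ∀ c ∈ C, 0 < c.2 := by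
    intro c hc
    have := mem_of_le hle hc
    simp at this
    omega
  have key : ∀ q : ℕ, (∀ c ∈ C, c.2 ≠ q) →
      (1 : ℝ) ≤ rsum ([12, 12, 3, 4, 6, 12].filter (fun n => decide (n ≠ q))) := by
    intro q hq
    have h1 := filter_le hle (fun n => n ≠ q)
    have h2 : C.filter (fun c => c.2 ≠ q) = C := Finset.filter_true_of_mem hq
    rw [h2] at h1
    exact (hC.density hpos).trans (rsum_of_le h1)
  by_cases h3 : ∀ c ∈ C, c.2 ≠ 3
  · have := key 3 h3
    norm_num [rsum, List.filter] at this
  by_cases h4 : ∀ c ∈ C, c.2 ≠ 4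
  · have := key 4 h4
    norm_num [rsum, List.filter] at this
  push Not at h3 h4
  obtain ⟨c, hc, hc3⟩ := h3
  obtain ⟨d, hd, hd4⟩ := h4
  have h1 := hC.density_strict hpos hc hd (by rintro rfl; omega) (by rw [hc3, hd4]; norm_num)
  have h2 := h1.trans_le (rsum_of_le hle)
  norm_num [rsum] at h2

lemma chkCert_spec (c : Cert) (D : List ℕ) (hpos : ∀ n ∈ D, 0 < n) (h : chkCert c D = true)
    (hD : Cov D) : False := by
  induction c generalizing D with
  | done =>
    simp only [chkCert, Nat.ble_eq] at h
    have h1 := fixsum_spec D hpos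
    have h2 := hD.one_le hpos
    have h3 : ((fixsum D + 1 : ℕ) : ℝ) ≤ ((1000000000 : ℕ) : ℝ) := by exact_mod_cast h
    push_cast at h3
    rw [le_div_iff₀ (by norm_num)] at h1
    nlinarith
  | disc p j c ih =>
    rw [chkCert, Bool.and_eq_true, Bool.and_eq_true, Nat.ble_eq] at h
    obtain ⟨⟨hp, hc⟩, hn⟩ := h
    exact ih _ (fun n hn => hpos n (List.mem_of_mem_filter hn)) hn
      (hD.discard hpos (smallPrime_spec hp) hc)
  | chain p j l c ih =>
    rw [chkCert, Bool.and_eq_true, Bool.and_eq_true, Bool.and_eq_true, Bool.and_eq_true,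
      Bool.and_eq_true, Nat.ble_eq, Nat.ble_eq, decide_eq_true_iff, List.all_eq_true] at h
    obtain ⟨⟨⟨⟨⟨hp, hc⟩, hno⟩, hl⟩, hl0⟩, hn⟩ := h
    refine ih _ ?_ hn (hD.chain hpos (smallPrime_spec hp) hc (fun n hn => of_decide_eq_true (hno n hn)) hl)
    intro n hn
    rcases List.mem_cons.1 hn with rfl | hn
    · exact hl0
    · exact hpos n (List.mem_of_mem_filter hn)
  | fin p B =>
    rw [chkCert, Bool.and_eq_true, Bool.and_eq_true, Bool.and_eq_true, Bool.and_eq_true,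
      Bool.and_eq_true, Nat.ble_eq, Nat.ble_eq, Nat.ble_eq, List.all_eq_true, List.all_eq_true] at h
    obtain ⟨⟨⟨⟨⟨hp, hB⟩, hc⟩, hno⟩, hv⟩, hs⟩ := h
    have h1 := hD.final hpos (j := 0) (smallPrime_spec hp) hB hc
      (fun n hn => of_decide_eq_true (hno n hn)) (by
        intro v hv1 hv0
        have := hv v (List.mem_range.2 hv1)
        rw [Bool.or_eq_true, Nat.ble_eq, Nat.beq_eq] at this
        exact this.resolve_left (by omega))
    have h2 := fixsum_spec (D.filter (fun n => decide (¬ p ^ (0 + 1) ∣ n)))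
      (fun n hn => hpos n (List.mem_of_mem_filter hn))
    have h3 := inv_le_fix hB
    generalize D.filter (fun n => decide (¬ p ^ (0 + 1) ∣ n)) = D' at *
    have h4 : ((fixsum D' + (1000000000 / B + 1) + 1 : ℕ) : ℝ) ≤ ((1000000000 : ℕ) : ℝ) := by
      exact_mod_cast hs
    rw [Nat.cast_add, Nat.cast_add] at h4
    push_cast at h4 h3
    rw [le_div_iff₀ (by norm_num)] at h2 h3
    nlinarith
  | three =>
    rw [chkCert, decide_eq_true_iff] at h
    rw [h] at hD
    exact three_false hD

/-- Check for a single value of `m`. -/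
def chkOne (m L : ℕ) (c : Cert) : Bool :=
  chkL m L 26 && chkCert c ((List.range' m (9 * m + 1)).filter (fun n => Nat.beq (L % n) 0))

lemma one_case {m L : ℕ} {c : Cert} (hchk : chkOne m L c = true) (hm : 3 ≤ m)
    {C : Finset (ℤ × ℕ)} (h : Covers C)
    (hrange : ∀ c ∈ C, m ≤ c.2 ∧ c.2 ≤ 10 * m)
    (hdist : ∀ c ∈ C, ∀ c' ∈ C, c ≠ c' → c.2 ≠ c'.2) : False := by
  rw [chkOne, Bool.and_eq_true] at hchk
  obtain ⟨C', hC', hcov, hred⟩ := exists_reduced h (by omega) hrange hdist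
  refine chkCert_spec c _ ?_ hchk.2 ⟨C', hcov, ?_⟩
  · intro n hn
    have := List.mem_range'_1.1 (List.mem_of_mem_filter hn)
    omega
  · rw [Multiset.le_iff_subset]
    · intro n hn
      obtain ⟨d, hd, rfl⟩ := Multiset.mem_map.1 hn
      have hd' : d ∈ C' := hd
      have h1 := hrange d (hC' hd')
      rw [Multiset.mem_coe, List.mem_filter, List.mem_range'_1]
      refine ⟨by omega, ?_⟩
      rw [Nat.beq_eq]
      exact Nat.mod_eq_zero_of_dvd (chkL_spec hchk.1 (hred d hd'))
    · apply Multiset.Nodup.map_on _ C'.nodup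
      intro x hx y hy he
      by_contra hne
      exact hdist x (hC' hx) y (hC' hy) hne he

end CovTen

namespace CovTen

lemma one3 : chkOne 3 720
    (Cert.disc 3 1 (Cert.disc 2 3 (Cert.chain 5 0 12 (Cert.chain 2 2 12 Cert.three)))) = true := by decide +kernel

lemma one4 : chkOne 4 1440
    (Cert.disc 2 4 (Cert.disc 2 3 (Cert.chain 3 1 12 (Cert.fin 5 6)))) = true := by decide +kernel

lemma one5 : chkOne 5 10080
    (Cert.disc 7 0 (Cert.disc 2 4 (Cert.fin 5 4))) = true := by decide +kernel

lemma one6 : chkOne 6 30240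
    (Cert.disc 3 2 (Cert.disc 2 4 (Cert.chain 7 0 120 (Cert.fin 5 4)))) = true := by decide +kernel

lemma one7 : chkOne 7 30240
    (Cert.disc 3 2 (Cert.disc 2 4 (Cert.fin 7 7))) = true := by decide +kernel

lemma one8 : chkOne 8 60480
    (Cert.disc 3 2 (Cert.disc 2 5 (Cert.disc 2 4 (Cert.fin 7 8)))) = true := by decide +kernel

lemma one9 : chkOne 9 60480
    (Cert.disc 3 2 (Cert.disc 2 5 (Cert.disc 2 4 (Cert.fin 7 5)))) = true := by decide +kernel

lemma one10 : chkOne 10 60480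
    (Cert.disc 3 2 Cert.done) = true := by decide +kernel

lemma one11 : chkOne 11 60480
    (Cert.done) = true := by decide +kernel

lemma one12 : chkOne 12 302400
    (Cert.disc 5 1 Cert.done) = true := by decide +kernel

lemma one13 : chkOne 13 3326400
    (Cert.disc 11 0 Cert.done) = true := by decide +kernel

lemma one14 : chkOne 14 3326400
    (Cert.disc 11 0 Cert.done) = true := by decide +kernel

lemma one15 : chkOne 15 6652800
    (Cert.disc 11 0 Cert.done) = true := by decide +kernel

lemma one16 : chkOne 16 6652800
    (Cert.disc 2 6 (Cert.disc 2 5 (Cert.fin 11 7))) = true := by decide +kernel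

lemma one17 : chkOne 17 6652800
    (Cert.disc 2 6 (Cert.disc 2 5 Cert.done)) = true := by decide +kernel

lemma one18 : chkOne 18 259459200
    (Cert.disc 13 0 (Cert.disc 3 3 (Cert.disc 2 6 (Cert.disc 2 5 (Cert.fin 11 6))))) = true := by decide +kernel

lemma one19 : chkOne 19 259459200
    (Cert.disc 13 0 Cert.done) = true := by decide +kernel

lemma one20 : chkOne 20 259459200
    (Cert.disc 3 3 (Cert.disc 2 6 (Cert.fin 11 18))) = true := by decide +kernel

lemma one21 : chkOne 21 259459200
    (Cert.disc 3 3 (Cert.disc 2 6 (Cert.fin 13 17))) = true := by decide +kernel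

lemma one22 : chkOne 22 259459200
    (Cert.disc 3 3 (Cert.disc 2 6 (Cert.fin 13 11))) = true := by decide +kernel

lemma one23 : chkOne 23 259459200
    (Cert.disc 3 3 (Cert.disc 2 6 (Cert.fin 13 8))) = true := by decide +kernel

lemma one24 : chkOne 24 259459200
    (Cert.disc 3 3 (Cert.disc 2 6 (Cert.fin 13 8))) = true := by decide +kernel

lemma one25 : chkOne 25 259459200
    (Cert.disc 3 3 (Cert.disc 2 6 (Cert.fin 13 6))) = true := by decide +kernel

lemma one26 : chkOne 26 259459200
    (Cert.disc 3 3 Cert.done) = true := by decide +kernel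

lemma one27 : chkOne 27 259459200
    (Cert.done) = true := by decide +kernel

lemma one28 : chkOne 28 259459200
    (Cert.done) = true := by decide +kernel

lemma one29 : chkOne 29 518918400
    (Cert.done) = true := by decide +kernel

lemma one30 : chkOne 30 518918400
    (Cert.done) = true := by decide +kernel

lemma one31 : chkOne 31 8821612800
    (Cert.disc 17 0 Cert.done) = true := by decide +kernel

lemma one32 : chkOne 32 8821612800
    (Cert.disc 17 0 Cert.done) = true := by decide +kernel

lemma one33 : chkOne 33 61751289600
    (Cert.disc 17 0 Cert.done) = true := by decide +kernel

lemma one34 : chkOne 34 61751289600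
    (Cert.disc 7 1 (Cert.disc 2 7 (Cert.disc 2 6 Cert.done))) = true := by decide +kernel

lemma one35 : chkOne 35 61751289600
    (Cert.disc 17 0 Cert.done) = true := by decide +kernel

lemma one36 : chkOne 36 61751289600
    (Cert.disc 7 1 Cert.done) = true := by decide +kernel

lemma one37 : chkOne 37 61751289600
    (Cert.done) = true := by decide +kernel

lemma one38 : chkOne 38 1173274502400
    (Cert.disc 19 0 Cert.done) = true := by decide +kernel

lemma one39 : chkOne 39 1173274502400
    (Cert.disc 19 0 (Cert.disc 7 1 Cert.done)) = true := by decide +kernel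

lemma one40 : chkOne 40 1173274502400
    (Cert.disc 19 0 Cert.done) = true := by decide +kernel

lemma one41 : chkOne 41 1173274502400
    (Cert.disc 19 0 Cert.done) = true := by decide +kernel

lemma one42 : chkOne 42 1173274502400
    (Cert.disc 2 7 (Cert.fin 19 29)) = true := by decide +kernel

lemma one43 : chkOne 43 1173274502400
    (Cert.disc 2 7 (Cert.fin 19 19)) = true := by decide +kernel

lemma one44 : chkOne 44 1173274502400
    (Cert.disc 2 7 (Cert.fin 19 20)) = true := by decide +kernel

lemma one45 : chkOne 45 1173274502400
    (Cert.disc 2 7 (Cert.fin 19 16)) = true := by decide +kernel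

lemma one46 : chkOne 46 1173274502400
    (Cert.disc 2 7 (Cert.fin 19 13)) = true := by decide +kernel

lemma one47 : chkOne 47 1173274502400
    (Cert.disc 2 7 (Cert.fin 19 13)) = true := by decide +kernel

lemma one48 : chkOne 48 1173274502400
    (Cert.disc 2 7 (Cert.fin 19 14)) = true := by decide +kernel

lemma one49 : chkOne 49 1173274502400
    (Cert.disc 2 7 (Cert.fin 19 11)) = true := by decide +kernel

lemma one50 : chkOne 50 1173274502400
    (Cert.disc 2 7 (Cert.fin 19 10)) = true := by decide +kernel

lemma one51 : chkOne 51 1173274502400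
    (Cert.done) = true := by decide +kernel

lemma one52 : chkOne 52 1173274502400
    (Cert.done) = true := by decide +kernel

lemma one53 : chkOne 53 1173274502400
    (Cert.done) = true := by decide +kernel

lemma one54 : chkOne 54 3519823507200
    (Cert.done) = true := by decide +kernel

lemma one55 : chkOne 55 3519823507200
    (Cert.done) = true := by decide +kernel

lemma one56 : chkOne 56 17599117536000
    (Cert.done) = true := by decide +kernel

lemma one57 : chkOne 57 809559406656000
    (Cert.disc 23 0 Cert.done) = true := by decide +kernel

lemma one58 : chkOne 58 809559406656000
    (Cert.disc 23 0 Cert.done) = true := by decide +kernel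

lemma one59 : chkOne 59 809559406656000
    (Cert.disc 23 0 Cert.done) = true := by decide +kernel

lemma one60 : chkOne 60 809559406656000
    (Cert.disc 5 2 (Cert.disc 3 4 (Cert.disc 2 8 (Cert.disc 2 7 (Cert.fin 23 13))))) = true := by decide +kernel

lemma one61 : chkOne 61 809559406656000
    (Cert.disc 5 2 (Cert.disc 3 4 (Cert.disc 2 8 (Cert.disc 2 7 (Cert.fin 23 11))))) = true := by decide +kernel

lemma one62 : chkOne 62 809559406656000
    (Cert.disc 5 2 (Cert.disc 3 4 (Cert.disc 2 8 (Cert.disc 2 7 (Cert.fin 23 11))))) = true := by decide +kernel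

lemma one63 : chkOne 63 809559406656000
    (Cert.disc 5 2 (Cert.disc 3 4 (Cert.disc 2 8 (Cert.disc 2 7 (Cert.fin 23 12))))) = true := by decide +kernel

lemma one64 : chkOne 64 809559406656000
    (Cert.disc 5 2 (Cert.disc 3 4 (Cert.disc 2 8 (Cert.disc 2 7 (Cert.fin 23 10))))) = true := by decide +kernel

lemma one65 : chkOne 65 809559406656000
    (Cert.disc 5 2 (Cert.disc 3 4 Cert.done)) = true := by decide +kernel

lemma one66 : chkOne 66 809559406656000
    (Cert.disc 5 2 Cert.done) = true := by decide +kernel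

lemma small_range {m : ℕ} (hm3 : 3 ≤ m) (hm : m ≤ 66) {C : Finset (ℤ × ℕ)} (h : Covers C)
    (hrange : ∀ c ∈ C, m ≤ c.2 ∧ c.2 ≤ 10 * m)
    (hdist : ∀ c ∈ C, ∀ c' ∈ C, c ≠ c' → c.2 ≠ c'.2) : False := by
  interval_cases m
  · exact one_case one3 hm3 h hrange hdist
  · exact one_case one4 hm3 h hrange hdist
  · exact one_case one5 hm3 h hrange hdist
  · exact one_case one6 hm3 h hrange hdist
  · exact one_case one7 hm3 h hrange hdist
  · exact one_case one8 hm3 h hrange hdist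
  · exact one_case one9 hm3 h hrange hdist
  · exact one_case one10 hm3 h hrange hdist
  · exact one_case one11 hm3 h hrange hdist
  · exact one_case one12 hm3 h hrange hdist
  · exact one_case one13 hm3 h hrange hdist
  · exact one_case one14 hm3 h hrange hdist
  · exact one_case one15 hm3 h hrange hdist
  · exact one_case one16 hm3 h hrange hdist
  · exact one_case one17 hm3 h hrange hdist
  · exact one_case one18 hm3 h hrange hdist
  · exact one_case one19 hm3 h hrange hdist
  · exact one_case one20 hm3 h hrange hdist
  · exact one_case one21 hm3 h hrange hdist
  · exact one_case one22 hm3 h hrange hdist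
  · exact one_case one23 hm3 h hrange hdist
  · exact one_case one24 hm3 h hrange hdist
  · exact one_case one25 hm3 h hrange hdist
  · exact one_case one26 hm3 h hrange hdist
  · exact one_case one27 hm3 h hrange hdist
  · exact one_case one28 hm3 h hrange hdist
  · exact one_case one29 hm3 h hrange hdist
  · exact one_case one30 hm3 h hrange hdist
  · exact one_case one31 hm3 h hrange hdist
  · exact one_case one32 hm3 h hrange hdist
  · exact one_case one33 hm3 h hrange hdist
  · exact one_case one34 hm3 h hrange hdist
  · exact one_case one35 hm3 h hrange hdist
  · exact one_case one36 hm3 h hrange hdist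
  · exact one_case one37 hm3 h hrange hdist
  · exact one_case one38 hm3 h hrange hdist
  · exact one_case one39 hm3 h hrange hdist
  · exact one_case one40 hm3 h hrange hdist
  · exact one_case one41 hm3 h hrange hdist
  · exact one_case one42 hm3 h hrange hdist
  · exact one_case one43 hm3 h hrange hdist
  · exact one_case one44 hm3 h hrange hdist
  · exact one_case one45 hm3 h hrange hdist
  · exact one_case one46 hm3 h hrange hdist
  · exact one_case one47 hm3 h hrange hdist
  · exact one_case one48 hm3 h hrange hdist
  · exact one_case one49 hm3 h hrange hdist
  · exact one_case one50 hm3 h hrange hdist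
  · exact one_case one51 hm3 h hrange hdist
  · exact one_case one52 hm3 h hrange hdist
  · exact one_case one53 hm3 h hrange hdist
  · exact one_case one54 hm3 h hrange hdist
  · exact one_case one55 hm3 h hrange hdist
  · exact one_case one56 hm3 h hrange hdist
  · exact one_case one57 hm3 h hrange hdist
  · exact one_case one58 hm3 h hrange hdist
  · exact one_case one59 hm3 h hrange hdist
  · exact one_case one60 hm3 h hrange hdist
  · exact one_case one61 hm3 h hrange hdist
  · exact one_case one62 hm3 h hrange hdist
  · exact one_case one63 hm3 h hrange hdist
  · exact one_case one64 hm3 h hrange hdist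
  · exact one_case one65 hm3 h hrange hdist
  · exact one_case one66 hm3 h hrange hdist

end CovTen

namespace CovTen

/-- Product of `p ^ E` over primes `p ≤ k`. -/
def Q (E : ℕ) : ℕ → ℕ
  | 0 => 1
  | k + 1 => if (k + 1).Prime then Q E k * (k + 1) ^ E else Q E k

/-- `(4/3)` to the number of primes in `(29, k]` dividing `n`. -/
noncomputable def F : ℕ → ℕ → ℝ
  | 0, _ => 1
  | k + 1, n => F k n * (if (k + 1).Prime ∧ 29 < k + 1 ∧ (k + 1) ∣ n then 4 / 3 else 1)

noncomputable def Pf : ℕ → ℝ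
  | 0 => 1
  | k + 1 => Pf k * (if (k + 1).Prime ∧ 29 < k + 1 then 1 + 1 / (3 * ((k + 1 : ℕ) : ℝ)) else 1)

noncomputable def Gf : ℕ → ℝ
  | 0 => 1
  | k + 1 => Gf k * (if (k + 1).Prime then
      (if 29 < k + 1 then 1 + 16 / (9 * ((k + 1 : ℕ) : ℝ)) else 1 + 1 / ((k + 1 : ℕ) : ℝ)) else 1)

/-- Product of `p / (p-1)` over primes `p ≤ k`. -/
noncomputable def Rf : ℕ → ℝ
  | 0 => 1
  | k + 1 => Rf k * (if (k + 1).Prime then ((k + 1 : ℕ) : ℝ) / k else 1)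

lemma Q_pos (E k : ℕ) : 0 < Q E k := by
  induction k with
  | zero => simp [Q]
  | succ k ih => rw [Q]; split_ifs <;> positivity

lemma Q_dvd_succ (E k : ℕ) : Q E k ∣ Q E (k + 1) := by
  rw [Q]; split_ifs
  · exact dvd_mul_right _ _
  · exact dvd_rfl

lemma Q_dvd {E k l : ℕ} (h : k ≤ l) : Q E k ∣ Q E l := by
  induction l, h using Nat.le_induction with
  | base => exact dvd_rfl
  | succ l _ ih => exact ih.trans (Q_dvd_succ E l)

lemma Q_coprime (E : ℕ) {p k : ℕ} (hp : p.Prime) (h : k < p) : Nat.Coprime (Q E k) p := by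
  induction k with
  | zero => simp [Q]
  | succ k ih =>
    rw [Q]
    split_ifs with hk
    · apply Nat.Coprime.mul_left (ih (by omega))
      apply Nat.Coprime.pow_left
      rw [Nat.coprime_primes hk hp]
      omega
    · exact ih (by omega)

lemma pow_dvd_Q (E : ℕ) {p k : ℕ} (hp : p.Prime) (h : p ≤ k) : p ^ E ∣ Q E k := by
  obtain ⟨l, rfl⟩ : ∃ l, p = l + 1 := ⟨p - 1, by have := hp.pos; omega⟩
  refine dvd_trans ?_ (Q_dvd h)
  rw [Q, if_pos hp]
  exact dvd_mul_left _ _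

lemma dvd_Q {E k n : ℕ} (hn : 0 < n) (hE : n ≤ E) (hk : n ≤ k) : n ∣ Q E k := by
  rw [Nat.dvd_iff_prime_pow_dvd_dvd]
  intro p j hp hj
  have h1 : p ^ j ≤ n := Nat.le_of_dvd hn hj
  rcases j with _ | j
  · simp
  have h2 : p ≤ n := (Nat.le_self_pow (by omega) p).trans h1
  have h3 : j + 1 < p ^ (j + 1) := Nat.lt_pow_self hp.one_lt
  exact (pow_dvd_pow p (by omega)).trans (pow_dvd_Q E hp (h2.trans hk))

lemma F_one_le (k n : ℕ) : 1 ≤ F k n := by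
  induction k with
  | zero => simp [F]
  | succ k ih => rw [F]; split_ifs <;> linarith

lemma F_pos (k n : ℕ) : 0 < F k n := lt_of_lt_of_le one_pos (F_one_le k n)

lemma F_small {k : ℕ} (n : ℕ) (hk : k ≤ 29) : F k n = 1 := by
  induction k with
  | zero => simp [F]
  | succ k ih => rw [F, ih (by omega), if_neg (by omega)]; norm_num

lemma F_pow_mul {k p : ℕ} (hp : p.Prime) (h : k < p) (i n : ℕ) : F k (p ^ i * n) = F k n := by
  induction k with
  | zero => simp [F]
  | succ k ih =>
    rw [F, F, ih (by omega)]
    congr 1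
    apply if_congr _ rfl rfl
    apply and_congr_right
    intro hk
    apply and_congr_right
    intro _
    constructor
    · intro hd
      rcases (Nat.Prime.dvd_mul hk).1 hd with h1 | h1
      · exfalso
        have := hk.dvd_of_dvd_pow h1
        rw [Nat.prime_dvd_prime_iff_eq hk hp] at this
        omega
      · exact h1
    · intro hd; exact hd.mul_left _

lemma F_lcm (k a b : ℕ) : F k (Nat.lcm a b) ≤ F k a * F k b := by
  induction k with
  | zero => simp [F]
  | succ k ih =>
    rw [F, F, F]
    have ha := F_pos k a
    have hb := F_pos k b
    have hab := mul_pos ha hb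
    have key : (k + 1).Prime → (k + 1) ∣ Nat.lcm a b → (k + 1) ∣ a ∨ (k + 1) ∣ b := by
      intro hp hd
      exact (Nat.Prime.dvd_mul hp).1 (hd.trans (Nat.lcm_dvd_mul a b))
    split_ifs with h1 h2 h3 h3 h2 h3 h3 <;> first | nlinarith | skip
    exfalso
    rcases key h1.1 h1.2.2 with h | h
    · exact h2 ⟨h1.1, h1.2.1, h⟩
    · exact h3 ⟨h1.1, h1.2.1, h⟩

lemma Pf_one_le (k : ℕ) : 1 ≤ Pf k := by
  induction k with
  | zero => simp [Pf]
  | succ k ih =>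
    rw [Pf]; split_ifs
    · apply one_le_mul_of_one_le_of_one_le ih
      have : (0 : ℝ) ≤ 1 / (3 * ((k + 1 : ℕ) : ℝ)) := by positivity
      linarith
    · linarith

lemma Gf_pos (k : ℕ) : 0 < Gf k := by
  induction k with
  | zero => simp [Gf]
  | succ k ih =>
    rw [Gf]; split_ifs <;> positivity

lemma Pf_small {k : ℕ} (hk : k ≤ 29) : Pf k = 1 := by
  induction k with
  | zero => simp [Pf]
  | succ k ih => rw [Pf, ih (by omega), if_neg (by omega)]; norm_num

lemma harm_aux (a : ℕ) (ha : 1 ≤ a) :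
    ∑ j ∈ Finset.Ico a (10 * a + 1), 1 / (j : ℝ) ≤ 2929 / 1000 := by
  induction a, ha using Nat.le_induction with
  | base => norm_num [Finset.sum_Ico_succ_top]
  | succ a ha ih =>
    have h1 : ∑ j ∈ Finset.Ico a (10 * (a + 1) + 1), 1 / (j : ℝ) =
        ∑ j ∈ Finset.Ico a (10 * a + 1), 1 / (j : ℝ) +
        ∑ j ∈ Finset.Ico (10 * a + 1) (10 * (a + 1) + 1), 1 / (j : ℝ) :=
      (Finset.sum_Ico_consecutive _ (by omega) (by omega)).symm
    have h2 : ∑ j ∈ Finset.Ico a (10 * (a + 1) + 1), 1 / (j : ℝ) =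
        1 / (a : ℝ) + ∑ j ∈ Finset.Ico (a + 1) (10 * (a + 1) + 1), 1 / (j : ℝ) :=
      Finset.sum_eq_sum_Ico_succ_bot (by omega) _
    have ha' : (0 : ℝ) < a := by exact_mod_cast ha
    have h3 : ∑ j ∈ Finset.Ico (10 * a + 1) (10 * (a + 1) + 1), 1 / (j : ℝ) ≤
        ∑ j ∈ Finset.Ico (10 * a + 1) (10 * (a + 1) + 1), 1 / (10 * (a : ℝ)) := by
      apply Finset.sum_le_sum
      intro j hj
      have := (Finset.mem_Ico.1 hj).1
      have h4 : (10 * (a : ℝ)) ≤ j := by exact_mod_cast (by omega : 10 * a ≤ j)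
      exact one_div_le_one_div_of_le (by positivity) h4
    rw [Finset.sum_const, Nat.card_Ico] at h3
    have e : 10 * (a + 1) + 1 - (10 * a + 1) = 10 := by omega
    rw [e] at h3
    have h5 : (10 : ℕ) • (1 / (10 * (a : ℝ))) = 1 / (a : ℝ) := by
      rw [nsmul_eq_mul]; field_simp; norm_num
    rw [h5] at h3
    linarith

/-- `∑ F k n / n` over multiples of `D` in `[m, 10m]`. -/
noncomputable def U (m k D : ℕ) : ℝ :=
  ∑ n ∈ (Finset.Icc m (10 * m)).filter (fun n => D ∣ n), F k n / n

lemma U_base (m D : ℕ) (hm : 0 < m) (hD : 0 < D) :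
    ∑ n ∈ (Finset.Icc m (10 * m)).filter (fun n => D ∣ n), 1 / (n : ℝ) ≤ (2929 / 1000) / D := by
  set a := (m + D - 1) / D with ha
  have ha1 : 1 ≤ a := by
    rw [ha, Nat.le_div_iff_mul_le hD]; omega
  have hma : m ≤ D * a := by
    have h1 : m + D - 1 < D * (a + 1) := Nat.lt_mul_div_succ _ hD
    have h2 : D * (a + 1) = D * a + D := by ring
    omega
  have h1 : ∑ n ∈ (Finset.Icc m (10 * m)).filter (fun n => D ∣ n), 1 / (n : ℝ) ≤
      ∑ n ∈ (Finset.Ico a (10 * a + 1)).image (fun j => D * j), 1 / (n : ℝ) := by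
    apply Finset.sum_le_sum_of_subset_of_nonneg
    · intro n hn
      rw [Finset.mem_filter, Finset.mem_Icc] at hn
      obtain ⟨⟨h1, h2⟩, j, rfl⟩ := hn
      apply Finset.mem_image_of_mem
      rw [Finset.mem_Ico]
      constructor
      · rw [ha]
        apply Nat.le_of_lt_succ
        rw [Nat.div_lt_iff_lt_mul hD]
        have : j.succ * D = D * j + D := by rw [Nat.succ_mul, mul_comm]
        omega
      · have h3 : D * j ≤ D * (10 * a) := by
          calc D * j ≤ 10 * m := h2
            _ ≤ 10 * (D * a) := by omega
            _ = D * (10 * a) := by ring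
        have := Nat.le_of_mul_le_mul_left h3 hD
        omega
    · intros; positivity
  refine h1.trans ?_
  rw [Finset.sum_image (fun x _ y _ h => Nat.eq_of_mul_eq_mul_left hD h)]
  have h2 : ∀ j ∈ Finset.Ico a (10 * a + 1), 1 / ((D * j : ℕ) : ℝ) = (1 / (D : ℝ)) * (1 / (j : ℝ)) := by
    intro j _
    push_cast
    rw [one_div_mul_one_div]
  rw [Finset.sum_congr rfl h2, ← Finset.mul_sum]
  have := harm_aux a ha1
  have hD' : (0 : ℝ) < 1 / D := by positivity
  calc _ ≤ (1 / (D : ℝ)) * (2929 / 1000) := by gcongr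
    _ = _ := by ring

lemma U_nonneg (m k D : ℕ) : 0 ≤ U m k D :=
  Finset.sum_nonneg (fun n _ => div_nonneg (F_pos k n).le (by positivity))

lemma U_bound (m k D : ℕ) (hm : 0 < m) (hD : 0 < D) :
    U m k D ≤ F k D * ((2929 / 1000) / D) * Pf k := by
  induction k generalizing D with
  | zero =>
    have := U_base m D hm hD
    simpa [U, F, Pf] using this
  | succ k ih =>
    have h0 := ih D hD
    have hF := F_pos k D
    have hP : 0 < Pf k := lt_of_lt_of_le one_pos (Pf_one_le k)
    by_cases hk : (k + 1).Prime ∧ 29 < k + 1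
    · have hq : (0 : ℝ) < ((k + 1 : ℕ) : ℝ) := by positivity
      have hD' : (0 : ℝ) < D := by exact_mod_cast hD
      by_cases hd : (k + 1) ∣ D
      · have h1 : U m (k + 1) D = 4 / 3 * U m k D := by
          unfold U
          rw [Finset.mul_sum]
          apply Finset.sum_congr rfl
          intro n hn
          rw [F, if_pos ⟨hk.1, hk.2, hd.trans (Finset.mem_filter.1 hn).2⟩]
          ring
        rw [h1, F, if_pos ⟨hk.1, hk.2, hd⟩, Pf, if_pos hk]
        have h2 : (0 : ℝ) ≤ 1 / (3 * ((k + 1 : ℕ) : ℝ)) := by positivity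
        have h3 : 0 ≤ F k D * ((2929 / 1000) / D) * Pf k := by positivity
        nlinarith [mul_nonneg h3 h2]
      · have hcop : Nat.Coprime D (k + 1) := by
          rw [Nat.coprime_comm, Nat.Prime.coprime_iff_not_dvd hk.1]; exact hd
        have h1 : U m (k + 1) D = U m k D + 1 / 3 * U m k ((k + 1) ^ 1 * D) := by
          unfold U
          have e : (Finset.Icc m (10 * m)).filter (fun n => (k + 1) ^ 1 * D ∣ n) =
              ((Finset.Icc m (10 * m)).filter (fun n => D ∣ n)).filter (fun n => (k + 1) ∣ n) := by
            rw [Finset.filter_filter]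
            apply Finset.filter_congr
            intro n _
            constructor
            · intro h
              rw [pow_one] at h
              exact ⟨dvd_of_mul_left_dvd h, dvd_of_mul_right_dvd h⟩
            · rintro ⟨h1, h2⟩
              rw [pow_one, mul_comm]
              exact hcop.mul_dvd_of_dvd_of_dvd h1 h2
          rw [e, Finset.mul_sum, Finset.sum_filter (s := (Finset.Icc m (10 * m)).filter (fun n => D ∣ n)),
            ← Finset.sum_add_distrib]
          apply Finset.sum_congr rfl
          intro n _
          rw [F]
          by_cases hn : (k + 1) ∣ n
          · rw [if_pos ⟨hk.1, hk.2, hn⟩, if_pos hn]; ring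
          · rw [if_neg (fun h => hn h.2.2), if_neg hn]; ring
        have h2 := ih ((k + 1) ^ 1 * D) (by positivity)
        rw [F_pow_mul hk.1 (by omega)] at h2
        rw [h1, F, if_neg (fun h => hd h.2.2), Pf, if_pos hk]
        have h3 : F k D * (2929 / 1000 / (((k + 1) ^ 1 * D : ℕ) : ℝ)) * Pf k =
            (F k D * (2929 / 1000 / (D : ℝ)) * Pf k) * (1 / ((k + 1 : ℕ) : ℝ)) := by
          push_cast; field_simp
        rw [h3] at h2
        have h4 : F k D * 1 * (2929 / 1000 / (D : ℝ)) * (Pf k * (1 + 1 / (3 * ((k + 1 : ℕ) : ℝ)))) =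
            F k D * (2929 / 1000 / (D : ℝ)) * Pf k + 1 / 3 * ((F k D * (2929 / 1000 / (D : ℝ)) * Pf k) * (1 / ((k + 1 : ℕ) : ℝ))) := by
          field_simp
        rw [h4]
        linarith
    · have h1 : ∀ n, F (k + 1) n = F k n := by
        intro n
        rw [F, if_neg (fun h => hk ⟨h.1, h.2.1⟩), mul_one]
      have h2 : U m (k + 1) D = U m k D := by
        unfold U
        apply Finset.sum_congr rfl
        intro n _
        rw [h1]
      rw [h2, h1, Pf, if_neg hk, mul_one]
      exact h0

lemma sum_divisors_mul_pow (M p E : ℕ) (hM : 0 < M) (hp : p.Prime) (hcop : Nat.Coprime M p) (h : ℕ → ℝ) :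
    ∑ g ∈ (M * p ^ E).divisors, h g = ∑ g ∈ M.divisors, ∑ i ∈ Finset.range (E + 1), h (p ^ i * g) := by
  have hc : Nat.Coprime M (p ^ E) := hcop.pow_right E
  rw [← Finset.sum_product' (f := fun g i => h (p ^ i * g))]
  symm
  apply Finset.sum_bij (fun (x : ℕ × ℕ) _ => p ^ x.2 * x.1)
  · rintro ⟨g, i⟩ hx
    rw [Finset.mem_product, Nat.mem_divisors, Finset.mem_range] at hx
    rw [Nat.mem_divisors]
    refine ⟨?_, by have := hp.pos; positivity⟩
    rw [mul_comm]
    exact mul_dvd_mul hx.1.1 (pow_dvd_pow p (by omega))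
  · rintro ⟨g, i⟩ hx ⟨g', i'⟩ hx' he
    rw [Finset.mem_product, Nat.mem_divisors, Finset.mem_range] at hx hx'
    simp only at he hx hx'
    have c1 : Nat.Coprime (p ^ i) g' := ((hcop.coprime_dvd_left hx'.1.1).pow_right i).symm
    have c2 : Nat.Coprime (p ^ i') g := ((hcop.coprime_dvd_left hx.1.1).pow_right i').symm
    have d1 : p ^ i ∣ p ^ i' := c1.dvd_of_dvd_mul_right (he ▸ dvd_mul_right _ _)
    have d2 : p ^ i' ∣ p ^ i := c2.dvd_of_dvd_mul_right (he ▸ dvd_mul_right _ _)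
    have e1 := Nat.dvd_antisymm d1 d2
    have e2 : i = i' := Nat.pow_right_injective hp.two_le e1
    subst e2
    have : 0 < p ^ i := by have := hp.pos; positivity
    have := Nat.eq_of_mul_eq_mul_left this he
    subst this; rfl
  · intro b hb
    rw [Nat.mem_divisors] at hb
    obtain ⟨y, z, hy, hz, he⟩ := exists_dvd_and_dvd_of_dvd_mul hb.1
    obtain ⟨i, hi, hzi⟩ := (Nat.dvd_prime_pow hp).1 hz
    refine ⟨(y, i), ?_, ?_⟩
    · rw [Finset.mem_product, Nat.mem_divisors, Finset.mem_range]
      exact ⟨⟨hy, by omega⟩, by simp only; omega⟩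
    · subst hzi
      simp only
      rw [he, mul_comm]
  · intros; rfl

end CovTen

namespace CovTen

lemma geom_phi (p : ℝ) (hp : 1 < p) (E : ℕ) :
    ∑ i ∈ Finset.range E, (p ^ i * (p - 1)) / (p ^ (i + 1)) ^ 2 = 1 / p - 1 / p ^ (E + 1) := by
  have hp0 : p ≠ 0 := by positivity
  induction E with
  | zero => simp
  | succ E ih =>
    rw [Finset.sum_range_succ, ih]
    field_simp
    ring

lemma geom_inv (p : ℝ) (hp : 1 < p) (E : ℕ) :
    ∑ i ∈ Finset.range (E + 1), 1 / p ^ i ≤ p / (p - 1) := by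
  have hp0 : p ≠ 0 := by positivity
  have hp1 : p - 1 ≠ 0 := by linarith
  have h : ∑ i ∈ Finset.range (E + 1), 1 / p ^ i = p / (p - 1) - 1 / (p ^ E * (p - 1)) := by
    induction E with
    | zero => simp; field_simp
    | succ E ih =>
      rw [Finset.sum_range_succ, ih]
      field_simp
      ring
  rw [h]
  have : 0 < p - 1 := by linarith
  have : 0 < 1 / (p ^ E * (p - 1)) := by positivity
  linarith

lemma R_bound (E k : ℕ) : ∑ g ∈ (Q E k).divisors, 1 / (g : ℝ) ≤ Rf k := by
  induction k with
  | zero => simp [Q, Rf]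
  | succ k ih =>
    rw [Q, Rf]
    split_ifs with hk
    · rw [sum_divisors_mul_pow _ _ _ (Q_pos E k) hk (Q_coprime E hk (by omega))]
      have hp1 : (1 : ℝ) < ((k + 1 : ℕ) : ℝ) := by exact_mod_cast hk.one_lt
      have hg := geom_inv _ hp1 E
      have e : ((k + 1 : ℕ) : ℝ) - 1 = k := by push_cast; ring
      rw [e] at hg
      calc _ = ∑ g ∈ (Q E k).divisors, (1 / (g : ℝ)) *
            ∑ i ∈ Finset.range (E + 1), 1 / ((k + 1 : ℕ) : ℝ) ^ i := by
            apply Finset.sum_congr rfl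
            intro g _
            rw [Finset.mul_sum]
            apply Finset.sum_congr rfl
            intro i _
            rw [Nat.cast_mul, Nat.cast_pow, one_div_mul_one_div, mul_comm]
        _ = (∑ g ∈ (Q E k).divisors, (1 / (g : ℝ))) *
            ∑ i ∈ Finset.range (E + 1), 1 / ((k + 1 : ℕ) : ℝ) ^ i := by rw [Finset.sum_mul]
        _ ≤ _ := by
            apply mul_le_mul ih hg
            · positivity
            · exact le_trans (Finset.sum_nonneg (fun _ _ => by positivity)) ih
    · rw [mul_one]; exact ih

lemma G_bound (E k : ℕ) :
    ∑ g ∈ (Q E k).divisors, (Nat.totient g : ℝ) * F k g ^ 2 / (g : ℝ) ^ 2 ≤ Gf k := by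
  induction k with
  | zero => simp [Q, Gf, F]
  | succ k ih =>
    by_cases hk : (k + 1).Prime
    · have hQ : Q E (k + 1) = Q E k * (k + 1) ^ E := by rw [Q, if_pos hk]
      rw [hQ, sum_divisors_mul_pow _ _ _ (Q_pos E k) hk (Q_coprime E hk (by omega))]
      set p := k + 1 with hpdef
      have hp1 : (1 : ℝ) < (p : ℝ) := by exact_mod_cast hk.one_lt
      have hp0 : (0 : ℝ) < p := by linarith
      set c : ℝ := if 29 < p then 16 / 9 else 1 with hc
      have hc0 : 0 ≤ c := by rw [hc]; split_ifs <;> norm_num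
      have hgeom := geom_phi p hp1 E
      have hle : ∑ i ∈ Finset.range E, ((p : ℝ) ^ i * (p - 1)) / ((p : ℝ) ^ (i + 1)) ^ 2 ≤ 1 / (p : ℝ) := by
        rw [hgeom]
        have : 0 < 1 / (p : ℝ) ^ (E + 1) := by positivity
        linarith
      have hterm : ∀ g ∈ (Q E k).divisors,
          ∑ i ∈ Finset.range (E + 1), (Nat.totient (p ^ i * g) : ℝ) * F p (p ^ i * g) ^ 2 /
            ((p ^ i * g : ℕ) : ℝ) ^ 2 =
          ((Nat.totient g : ℝ) * F k g ^ 2 / (g : ℝ) ^ 2) *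
            (1 + c * ∑ i ∈ Finset.range E, ((p : ℝ) ^ i * (p - 1)) / ((p : ℝ) ^ (i + 1)) ^ 2) := by
        intro g hg
        have hgd := (Nat.mem_divisors.1 hg).1
        have hg0 : 0 < g := Nat.pos_of_dvd_of_pos hgd (Q_pos E k)
        have hg0' : (0 : ℝ) < g := by exact_mod_cast hg0
        have hcg : Nat.Coprime g p := (Q_coprime E hk (by omega)).coprime_dvd_left hgd
        have hndvd : ¬ p ∣ g := by
          rw [Nat.coprime_comm, Nat.Prime.coprime_iff_not_dvd hk] at hcg
          exact hcg
        rw [Finset.sum_range_succ']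
        have h0 : F p (p ^ 0 * g) = F k g := by
          rw [pow_zero, one_mul, hpdef, F, if_neg (fun h => hndvd h.2.2), mul_one]
        have hi : ∀ i, F p (p ^ (i + 1) * g) ^ 2 = F k g ^ 2 * c := by
          intro i
          have e : F p (p ^ (i + 1) * g) = F k (p ^ (i + 1) * g) *
            (if p.Prime ∧ 29 < p ∧ p ∣ (p ^ (i + 1) * g) then 4 / 3 else 1) := by
            rw [hpdef, F]
          rw [e, F_pow_mul hk (by omega), hc]
          have hd : p ∣ p ^ (i + 1) * g := (dvd_pow_self p (by omega)).mul_right g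
          by_cases h29 : 29 < p
          · rw [if_pos ⟨hk, h29, hd⟩, if_pos h29]; ring
          · rw [if_neg (fun h => h29 h.2.1), if_neg h29]; ring
        rw [h0, mul_add, mul_one, add_comm, Finset.mul_sum, Finset.mul_sum]
        congr 1
        · simp
        · apply Finset.sum_congr rfl
          intro i _
          rw [hi, Nat.totient_mul ((hcg.pow_right (i + 1)).symm), Nat.totient_prime_pow_succ hk,
            Nat.cast_mul, Nat.cast_mul, Nat.cast_mul, Nat.cast_sub hk.one_lt.le]
          push_cast
          field_simp
      rw [Finset.sum_congr rfl hterm, ← Finset.sum_mul]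
      have hGf : Gf p = Gf k * (1 + c * (1 / (p : ℝ))) := by
        rw [hpdef, Gf, if_pos hk, ← hpdef, hc]
        split_ifs
        · congr 2; field_simp
        · rw [one_mul]
      rw [hGf]
      apply mul_le_mul ih
      · gcongr
      · have : 0 ≤ ∑ i ∈ Finset.range E, ((p : ℝ) ^ i * (p - 1)) / ((p : ℝ) ^ (i + 1)) ^ 2 := by
          apply Finset.sum_nonneg
          intro i _
          have : 0 ≤ (p : ℝ) - 1 := by linarith
          positivity
        positivity
      · exact (Gf_pos k).le
    · have hQ : Q E (k + 1) = Q E k := by rw [Q, if_neg hk]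
      rw [hQ, Gf, if_neg hk, mul_one]
      have h1 : ∀ n, F (k + 1) n = F k n := by
        intro n
        rw [F, if_neg (fun h => hk h.1), mul_one]
      simp only [h1]
      exact ih

end CovTen

namespace CovTen

open Function in
lemma mean_shift {N : ℕ} {f : ℤ → ℝ} (hf : Periodic f (N : ℤ)) (s : ℕ) :
    mean N (fun x => f (x + s)) = mean N f := by
  unfold mean
  congr 1
  induction s with
  | zero => simp
  | succ s ih =>
    rw [← ih]
    have h1 := Finset.sum_range_succ (fun x : ℕ => f ((x : ℤ) + s)) N
    have h2 := Finset.sum_range_succ' (fun x : ℕ => f ((x : ℤ) + s)) N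
    have h3 : f ((N : ℤ) + s) = f (((0 : ℕ) : ℤ) + s) := by
      rw [add_comm, hf]; simp
    rw [h3] at h1
    have h4 : ∑ x ∈ Finset.range N, f ((x : ℤ) + ((s + 1 : ℕ) : ℤ)) =
        ∑ x ∈ Finset.range N, f (((x + 1 : ℕ) : ℤ) + s) := by
      apply Finset.sum_congr rfl
      intro x _
      congr 1
      push_cast; ring
    rw [h4]
    linarith

lemma mean_mono {N : ℕ} {f g : ℤ → ℝ} (h : ∀ x, f x ≤ g x) : mean N f ≤ mean N g := by
  unfold mean
  apply div_le_div_of_nonneg_right _ (by positivity)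
  exact Finset.sum_le_sum (fun x _ => h x)

lemma mean_add (N : ℕ) (f g : ℤ → ℝ) : mean N (fun x => f x + g x) = mean N f + mean N g := by
  unfold mean
  rw [Finset.sum_add_distrib, add_div]

lemma mean_const_mul (N : ℕ) (c : ℝ) (f : ℤ → ℝ) : mean N (fun x => c * f x) = c * mean N f := by
  unfold mean
  rw [← Finset.mul_sum, mul_div_assoc]

lemma mean_sum {ι : Type} (N : ℕ) (s : Finset ι) (f : ι → ℤ → ℝ) :
    mean N (fun x => ∑ i ∈ s, f i x) = ∑ i ∈ s, mean N (f i) := by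
  unfold mean
  rw [Finset.sum_comm, Finset.sum_div]

lemma mean_one {N : ℕ} (hN : 0 < N) : mean N (fun _ => 1) = 1 := by
  unfold mean
  have : (N : ℝ) ≠ 0 := by positivity
  simp [this]

/-- Average along the progression `x + i * M`, `i < q`. -/
noncomputable def Av (M q : ℕ) (f : ℤ → ℝ) (x : ℤ) : ℝ :=
  (∑ i ∈ Finset.range q, f (x + i * M)) / q

lemma mean_Av {N M q : ℕ} (hq : 0 < q) {f : ℤ → ℝ} (hf : Function.Periodic f (N : ℤ)) :
    mean N (Av M q f) = mean N f := by
  have h1 : mean N (Av M q f) = (∑ i ∈ Finset.range q, mean N (fun x => f (x + ((i * M : ℕ) : ℤ)))) / q := by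
    unfold Av mean
    rw [← Finset.sum_div, ← Finset.sum_div, Finset.sum_comm, div_right_comm]
    push_cast
    rfl
  rw [h1, Finset.sum_congr rfl (fun i _ => mean_shift hf (i * M))]
  have : (q : ℝ) ≠ 0 := by positivity
  simp [this]

lemma Av_per {M q : ℕ} {f : ℤ → ℝ} (hf : Function.Periodic f ((M * q : ℕ) : ℤ)) :
    Function.Periodic (Av M q f) (M : ℤ) := by
  intro x
  unfold Av
  congr 1
  have h1 := Finset.sum_range_succ (fun i : ℕ => f (x + i * M)) q
  have h2 := Finset.sum_range_succ' (fun i : ℕ => f (x + i * M)) q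
  have h3 : f (x + q * M) = f (x + ((0 : ℕ) : ℤ) * M) := by
    have := hf x
    push_cast at this
    rw [mul_comm, this]; simp
  have h4 : ∑ i ∈ Finset.range q, f (x + M + i * M) =
      ∑ i ∈ Finset.range q, f (x + ((i + 1 : ℕ) : ℤ) * M) := by
    apply Finset.sum_congr rfl
    intro i _
    congr 1
    push_cast; ring
  rw [h4]
  linarith

lemma Av_mul {M q : ℕ} {f g : ℤ → ℝ} (hg : Function.Periodic g (M : ℤ)) (x : ℤ) :
    Av M q (fun x => g x * f x) x = g x * Av M q f x := by
  unfold Av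
  rw [← mul_div_assoc, Finset.mul_sum]
  congr 1
  apply Finset.sum_congr rfl
  intro i _
  have := hg.nat_mul i x
  simp only [this]

lemma cls_per (a : ℤ) {n N : ℕ} (h : n ∣ N) : Function.Periodic (cls a n) (N : ℤ) := by
  intro x
  unfold cls
  have h1 : (n : ℤ) ∣ (N : ℤ) := by exact_mod_cast h
  apply if_congr _ rfl rfl
  have : x + (N : ℤ) - a = (x - a) + N := by ring
  rw [this]
  exact (Int.dvd_add_left h1)

lemma cls_mul_coprime (a : ℤ) {m n : ℕ} (h : Nat.Coprime m n) (x : ℤ) :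
    cls a (m * n) x = cls a n x * cls a m x := by
  unfold cls
  have hc : IsCoprime (m : ℤ) (n : ℤ) := Nat.isCoprime_iff_coprime.2 h
  by_cases h1 : (n : ℤ) ∣ x - a
  · by_cases h2 : (m : ℤ) ∣ x - a
    · rw [if_pos h1, if_pos h2, if_pos (by push_cast; exact hc.mul_dvd h2 h1)]; norm_num
    · rw [if_neg h2, if_neg]
      · simp
      · intro h3; push_cast at h3; exact h2 (dvd_of_mul_right_dvd h3)
  · rw [if_neg h1, if_neg]
    · simp
    · intro h3; push_cast at h3; exact h1 (dvd_of_mul_left_dvd h3)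

lemma Av_cls {M p E i d : ℕ} (a : ℤ) (hp : p.Prime) (hcop : Nat.Coprime M p) (hi : i ≤ E) (hd : d ∣ M)
    (x : ℤ) : Av M (p ^ E) (cls a (p ^ i * d)) x = cls a d x / (p : ℝ) ^ i := by
  have hp0 := hp.pos
  have hc1 : Nat.Coprime (p ^ i) d := ((hcop.coprime_dvd_left hd).pow_right i).symm
  have h1 : cls a (p ^ i * d) = fun x => cls a d x * cls a (p ^ i) x :=
    funext (fun x => cls_mul_coprime a hc1 x)
  rw [h1, Av_mul (cls_per a hd)]
  have hcM : IsCoprime (M : ℤ) ((p ^ i : ℕ) : ℤ) := Nat.isCoprime_iff_coprime.2 (hcop.pow_right i)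
  obtain ⟨u, v, huv⟩ := hcM
  have h2 : ∀ t : ℕ, cls a (p ^ i) (x + t * M) = cls ((a - x) * u) (p ^ i) (t : ℤ) := by
    intro t
    unfold cls
    apply if_congr _ rfl rfl
    constructor
    · intro h
      have e : (t : ℤ) - (a - x) * u = (x + t * M - a) * u + ((p ^ i : ℕ) : ℤ) * (v * t) := by
        linear_combination (- (t : ℤ)) * huv
      rw [e]
      exact dvd_add (h.mul_right _) (dvd_mul_right _ _)
    · intro h
      have e : x + t * M - a = ((t : ℤ) - (a - x) * u) * M + ((p ^ i : ℕ) : ℤ) * (v * (x - a)) := by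
        linear_combination (a - x) * huv
      rw [e]
      exact dvd_add (h.mul_right _) (dvd_mul_right _ _)
  have h3 : Av M (p ^ E) (cls a (p ^ i)) x = 1 / (p : ℝ) ^ i := by
    unfold Av
    simp only [h2]
    obtain ⟨j, rfl⟩ := Nat.exists_eq_add_of_le hi
    rw [pow_add, sum_cls_mul _ _ (by positivity)]
    push_cast
    have : (p : ℝ) ≠ 0 := by positivity
    field_simp
  rw [h3]; ring

lemma cls_mul_cls (a b : ℤ) (m n : ℕ) :
    ∃ c : ℤ, ∀ x, cls a m x * cls b n x ≤ cls c (Nat.lcm m n) x := by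
  by_cases h : ∃ x0 : ℤ, (m : ℤ) ∣ x0 - a ∧ (n : ℤ) ∣ x0 - b
  · obtain ⟨x0, h1, h2⟩ := h
    refine ⟨x0, fun x => ?_⟩
    by_cases h3 : (m : ℤ) ∣ x - a ∧ (n : ℤ) ∣ x - b
    · have h4 : ((Nat.lcm m n : ℕ) : ℤ) ∣ x - x0 := by
        rw [Int.natCast_dvd]
        apply Nat.lcm_dvd <;> rw [← Int.natCast_dvd]
        · have := dvd_sub h3.1 h1
          simpa using this
        · have := dvd_sub h3.2 h2
          simpa using this
      unfold cls
      rw [if_pos h3.1, if_pos h3.2, if_pos h4]; norm_num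
    · have : cls a m x * cls b n x = 0 := by
        unfold cls
        by_cases h5 : (m : ℤ) ∣ x - a
        · rw [if_neg (fun h6 => h3 ⟨h5, h6⟩)]; simp
        · rw [if_neg h5]; simp
      rw [this]; exact cls_nonneg _ _ _
  · refine ⟨0, fun x => ?_⟩
    have : cls a m x * cls b n x = 0 := by
      unfold cls
      by_cases h5 : (m : ℤ) ∣ x - a
      · rw [if_neg (fun h6 => h ⟨x, h5, h6⟩)]; simp
      · rw [if_neg h5]; simp
    rw [this]; exact cls_nonneg _ _ _

end CovTen

namespace CovTen

/-- The moduli in `[m, 10m]` whose largest prime factor is `p = k + 1`. -/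
def Sp (m E k : ℕ) : Finset ℕ :=
  (Finset.Icc m (10 * m)).filter (fun n => (k + 1) ∣ n ∧ n ∣ Q E (k + 1))

open Classical in
/-- Indicator of the union of the classes with modulus in `Sp`. -/
noncomputable def Bad (m E k : ℕ) (r : ℕ → ℤ) (x : ℤ) : ℝ :=
  if ∃ n ∈ Sp m E k, (n : ℤ) ∣ x - r n then 1 else 0

structure Inv (m N E : ℕ) (r : ℕ → ℤ) (k : ℕ) (w : ℤ → ℝ) (μ : ℝ) : Prop where
  nonneg : ∀ x, 0 ≤ w x
  per : Function.Periodic w (Q E k : ℤ)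
  zero : ∀ n ∈ Finset.Icc m (10 * m), n ∣ Q E k → ∀ x : ℤ, (n : ℤ) ∣ x - r n → w x = 0
  bd : ∀ d : ℕ, d ∣ Q E k → ∀ a : ℤ, mean N (fun x => w x * cls a d x) ≤ F k d / d
  mass : μ ≤ mean N w

lemma Bad_nonneg (m E k : ℕ) (r : ℕ → ℤ) (x : ℤ) : 0 ≤ Bad m E k r x := by
  unfold Bad; split_ifs <;> norm_num

lemma Bad_le (m E k : ℕ) (r : ℕ → ℤ) (x : ℤ) :
    Bad m E k r x ≤ ∑ n ∈ Sp m E k, cls (r n) n x := by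
  unfold Bad
  split_ifs with h
  · obtain ⟨n, hn, hd⟩ := h
    have h1 : cls (r n) n x = 1 := by unfold cls; rw [if_pos hd]
    rw [← h1]
    exact Finset.single_le_sum (f := fun n => cls (r n) n x) (fun n _ => cls_nonneg _ _ _) hn
  · exact Finset.sum_nonneg (fun n _ => cls_nonneg _ _ _)

lemma Bad_per (m E k : ℕ) (r : ℕ → ℤ) : Function.Periodic (Bad m E k r) (Q E (k + 1) : ℤ) := by
  intro x
  unfold Bad
  apply if_congr _ rfl rfl
  have key : ∀ n ∈ Sp m E k, ((n : ℤ) ∣ x + (Q E (k + 1) : ℤ) - r n ↔ (n : ℤ) ∣ x - r n) := by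
    intro n hn
    have h1 : (n : ℤ) ∣ (Q E (k + 1) : ℤ) := by
      exact_mod_cast (Finset.mem_filter.1 hn).2.2
    have : x + (Q E (k + 1) : ℤ) - r n = (x - r n) + Q E (k + 1) := by ring
    rw [this]
    exact Int.dvd_add_left h1
  constructor
  · rintro ⟨n, hn, hd⟩; exact ⟨n, hn, (key n hn).1 hd⟩
  · rintro ⟨n, hn, hd⟩; exact ⟨n, hn, (key n hn).2 hd⟩

lemma Q_succ_prime {E k : ℕ} (hk : (k + 1).Prime) : Q E (k + 1) = Q E k * (k + 1) ^ E := by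
  rw [Q, if_pos hk]

lemma split_dvd {E k n : ℕ} (hk : (k + 1).Prime) (hn : n ∣ Q E (k + 1)) :
    ∃ v c : ℕ, n = (k + 1) ^ v * c ∧ c ∣ Q E k ∧ v ≤ E := by
  rw [Q_succ_prime hk] at hn
  obtain ⟨y, z, hy, hz, he⟩ := exists_dvd_and_dvd_of_dvd_mul hn
  obtain ⟨i, hi, rfl⟩ := (Nat.dvd_prime_pow hk).1 hz
  exact ⟨i, y, by rw [he, mul_comm], hy, hi⟩

lemma Av_mono {M q : ℕ} {f g : ℤ → ℝ} (h : ∀ x, f x ≤ g x) (x : ℤ) : Av M q f x ≤ Av M q g x := by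
  unfold Av
  apply div_le_div_of_nonneg_right _ (by positivity)
  exact Finset.sum_le_sum (fun i _ => h _)

lemma Av_sum {ι : Type} (M q : ℕ) (s : Finset ι) (f : ι → ℤ → ℝ) (x : ℤ) :
    Av M q (fun x => ∑ i ∈ s, f i x) x = ∑ i ∈ s, Av M q (f i) x := by
  unfold Av
  rw [Finset.sum_comm, Finset.sum_div]

lemma gcd_le_sum {M a b n₁ n₂ : ℕ} (hM : 0 < M) (ha : a ∣ M) (h₁ : a ∣ n₁) (h₂ : b ∣ n₂) :
    (Nat.gcd a b : ℝ) ≤ ∑ g ∈ M.divisors, (Nat.totient g : ℝ) *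
      ((if g ∣ n₁ then 1 else 0) * (if g ∣ n₂ then 1 else 0)) := by
  have h := Nat.sum_totient (Nat.gcd a b)
  have h' : (Nat.gcd a b : ℝ) = ∑ g ∈ (Nat.gcd a b).divisors, (Nat.totient g : ℝ) := by
    exact_mod_cast h.symm
  rw [h']
  calc _ = ∑ g ∈ (Nat.gcd a b).divisors, (Nat.totient g : ℝ) *
      ((if g ∣ n₁ then 1 else 0) * (if g ∣ n₂ then 1 else 0)) := by
        apply Finset.sum_congr rfl
        intro g hg
        have hd := (Nat.mem_divisors.1 hg).1
        rw [if_pos ((hd.trans (Nat.gcd_dvd_left a b)).trans h₁),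
          if_pos ((hd.trans (Nat.gcd_dvd_right a b)).trans h₂)]
        ring
    _ ≤ _ := by
        apply Finset.sum_le_sum_of_subset_of_nonneg
        · exact Nat.divisors_subset_of_dvd hM.ne' ((Nat.gcd_dvd_left a b).trans ha)
        · intros; positivity

lemma second_moment {m N E : ℕ} {r : ℕ → ℤ} {k : ℕ} {w : ℤ → ℝ} {μ : ℝ} (hm : 0 < m)
    (hk : (k + 1).Prime) (hI : Inv m N E r k w μ) :
    mean N (fun x => w x * Av (Q E k) ((k + 1) ^ E) (Bad m E k r) x ^ 2) ≤
      (2929 / 1000) ^ 2 * (Pf k ^ 2 * Gf k) / ((k + 1 : ℕ) : ℝ) ^ 2 := by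
  set p := k + 1 with hpdef
  set M := Q E k with hM
  have hM0 : 0 < M := Q_pos E k
  have hcop : Nat.Coprime M p := Q_coprime E hk (by omega)
  have hp0 : (0 : ℝ) < p := by exact_mod_cast hk.pos
  have hsplit : ∀ n : ℕ, ∃ v c : ℕ, n ∈ Sp m E k → (n = p ^ v * c ∧ c ∣ M ∧ v ≤ E) := by
    intro n
    by_cases hn : n ∈ Sp m E k
    · obtain ⟨v, c, h⟩ := split_dvd hk (Finset.mem_filter.1 hn).2.2
      exact ⟨v, c, fun _ => h⟩
    · exact ⟨0, 0, fun h => absurd h hn⟩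
  choose v c hvc using hsplit
  have hα : ∀ x, Av M (p ^ E) (Bad m E k r) x ≤
      ∑ n ∈ Sp m E k, cls (r n) (c n) x / (p : ℝ) ^ v n := by
    intro x
    refine (Av_mono (Bad_le m E k r) x).trans ?_
    rw [Av_sum]
    apply le_of_eq
    apply Finset.sum_congr rfl
    intro n hn
    obtain ⟨h1, h2, h3⟩ := hvc n hn
    have := Av_cls (r n) hk hcop h3 h2 x
    rw [← h1] at this
    exact this
  have hα0 : ∀ x, 0 ≤ Av M (p ^ E) (Bad m E k r) x := by
    intro x
    unfold Av
    exact div_nonneg (Finset.sum_nonneg (fun _ _ => Bad_nonneg _ _ _ _ _)) (by positivity)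
  have hn0 : ∀ n ∈ Sp m E k, 0 < n := by
    intro n hn
    have := (Finset.mem_Icc.1 (Finset.mem_filter.1 hn).1).1
    omega
  have step1 : mean N (fun x => w x * Av M (p ^ E) (Bad m E k r) x ^ 2) ≤
      ∑ n₁ ∈ Sp m E k, ∑ n₂ ∈ Sp m E k, (1 / (p : ℝ) ^ v n₁ * (1 / (p : ℝ) ^ v n₂)) *
        mean N (fun x => w x * (cls (r n₁) (c n₁) x * cls (r n₂) (c n₂) x)) := by
    have h1 : ∀ x, w x * Av M (p ^ E) (Bad m E k r) x ^ 2 ≤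
        ∑ n₁ ∈ Sp m E k, ∑ n₂ ∈ Sp m E k, (1 / (p : ℝ) ^ v n₁ * (1 / (p : ℝ) ^ v n₂)) *
          (w x * (cls (r n₁) (c n₁) x * cls (r n₂) (c n₂) x)) := by
      intro x
      have h2 := pow_le_pow_left₀ (hα0 x) (hα x) 2
      calc _ ≤ w x * (∑ n ∈ Sp m E k, cls (r n) (c n) x / (p : ℝ) ^ v n) ^ 2 :=
            mul_le_mul_of_nonneg_left h2 (hI.nonneg x)
        _ = _ := by
            rw [sq, Finset.sum_mul_sum, Finset.mul_sum]
            apply Finset.sum_congr rfl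
            intro n₁ _
            rw [Finset.mul_sum]
            apply Finset.sum_congr rfl
            intro n₂ _
            ring
    refine (mean_mono h1).trans (le_of_eq ?_)
    rw [mean_sum]
    apply Finset.sum_congr rfl
    intro n₁ _
    rw [mean_sum]
    apply Finset.sum_congr rfl
    intro n₂ _
    rw [mean_const_mul]
  have step2 : ∀ n₁ ∈ Sp m E k, ∀ n₂ ∈ Sp m E k,
      (1 / (p : ℝ) ^ v n₁ * (1 / (p : ℝ) ^ v n₂)) *
        mean N (fun x => w x * (cls (r n₁) (c n₁) x * cls (r n₂) (c n₂) x)) ≤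
      ∑ g ∈ M.divisors, (Nat.totient g : ℝ) *
        ((if g ∣ n₁ then F k n₁ / n₁ else 0) * (if g ∣ n₂ then F k n₂ / n₂ else 0)) := by
    intro n₁ hn₁ n₂ hn₂
    obtain ⟨e1, d1, l1⟩ := hvc n₁ hn₁
    obtain ⟨e2, d2, l2⟩ := hvc n₂ hn₂
    obtain ⟨a, ha⟩ := cls_mul_cls (r n₁) (r n₂) (c n₁) (c n₂)
    have hl : Nat.lcm (c n₁) (c n₂) ∣ M := Nat.lcm_dvd d1 d2
    have h1 : mean N (fun x => w x * (cls (r n₁) (c n₁) x * cls (r n₂) (c n₂) x)) ≤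
        F k (Nat.lcm (c n₁) (c n₂)) / (Nat.lcm (c n₁) (c n₂) : ℕ) :=
      (mean_mono (fun x => mul_le_mul_of_nonneg_left (ha x) (hI.nonneg x))).trans (hI.bd _ hl a)
    have c1 : 0 < c n₁ := Nat.pos_of_dvd_of_pos d1 hM0
    have c2 : 0 < c n₂ := Nat.pos_of_dvd_of_pos d2 hM0
    have c1' : (0 : ℝ) < c n₁ := by exact_mod_cast c1
    have c2' : (0 : ℝ) < c n₂ := by exact_mod_cast c2
    have hlpos : 0 < Nat.lcm (c n₁) (c n₂) := Nat.lcm_pos c1 c2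
    have hlpos' : (0 : ℝ) < (Nat.lcm (c n₁) (c n₂) : ℕ) := by exact_mod_cast hlpos
    have hgl : ((Nat.gcd (c n₁) (c n₂) : ℕ) : ℝ) * (Nat.lcm (c n₁) (c n₂) : ℕ) = c n₁ * c n₂ := by
      exact_mod_cast Nat.gcd_mul_lcm (c n₁) (c n₂)
    have h2 : F k (Nat.lcm (c n₁) (c n₂)) / (Nat.lcm (c n₁) (c n₂) : ℕ) ≤
        (F k (c n₁) / c n₁) * (F k (c n₂) / c n₂) * (Nat.gcd (c n₁) (c n₂) : ℕ) := by
      rw [div_le_iff₀ hlpos', mul_assoc, hgl]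
      have : F k (c n₁) / c n₁ * (F k (c n₂) / c n₂) * (c n₁ * c n₂ : ℝ) = F k (c n₁) * F k (c n₂) := by
        field_simp
      rw [this]
      exact F_lcm k _ _
    have f1 : F k n₁ / n₁ = 1 / (p : ℝ) ^ v n₁ * (F k (c n₁) / c n₁) := by
      have : F k n₁ = F k (c n₁) := by
        conv_lhs => rw [e1]
        exact F_pow_mul hk (by omega) _ _
      have ee : (n₁ : ℝ) = (p : ℝ) ^ v n₁ * c n₁ := by exact_mod_cast e1
      rw [this, ee]
      field_simp
    have f2 : F k n₂ / n₂ = 1 / (p : ℝ) ^ v n₂ * (F k (c n₂) / c n₂) := by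
      have : F k n₂ = F k (c n₂) := by
        conv_lhs => rw [e2]
        exact F_pow_mul hk (by omega) _ _
      have ee : (n₂ : ℝ) = (p : ℝ) ^ v n₂ * c n₂ := by exact_mod_cast e2
      rw [this, ee]
      field_simp
    have hg := gcd_le_sum (b := c n₂) hM0 d1 (Dvd.intro_left _ e1.symm) (Dvd.intro_left _ e2.symm)
    have hpv : (0 : ℝ) ≤ 1 / (p : ℝ) ^ v n₁ * (1 / (p : ℝ) ^ v n₂) := by positivity
    have hF1 : 0 ≤ F k n₁ / n₁ := div_nonneg (F_pos _ _).le (by positivity)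
    have hF2 : 0 ≤ F k n₂ / n₂ := div_nonneg (F_pos _ _).le (by positivity)
    calc _ ≤ (1 / (p : ℝ) ^ v n₁ * (1 / (p : ℝ) ^ v n₂)) *
          ((F k (c n₁) / c n₁) * (F k (c n₂) / c n₂) * (Nat.gcd (c n₁) (c n₂) : ℕ)) :=
          mul_le_mul_of_nonneg_left (h1.trans h2) hpv
      _ = (F k n₁ / n₁) * (F k n₂ / n₂) * (Nat.gcd (c n₁) (c n₂) : ℕ) := by rw [f1, f2]; ring
      _ ≤ (F k n₁ / n₁) * (F k n₂ / n₂) * ∑ g ∈ M.divisors, (Nat.totient g : ℝ) *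
          ((if g ∣ n₁ then 1 else 0) * (if g ∣ n₂ then 1 else 0)) :=
          mul_le_mul_of_nonneg_left hg (mul_nonneg hF1 hF2)
      _ = _ := by
          rw [Finset.mul_sum]
          apply Finset.sum_congr rfl
          intro g _
          split_ifs <;> ring
  have step3 : ∑ n₁ ∈ Sp m E k, ∑ n₂ ∈ Sp m E k, ∑ g ∈ M.divisors, (Nat.totient g : ℝ) *
        ((if g ∣ n₁ then F k n₁ / n₁ else 0) * (if g ∣ n₂ then F k n₂ / n₂ else 0)) =
      ∑ g ∈ M.divisors, (Nat.totient g : ℝ) *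
        (∑ n ∈ Sp m E k, if g ∣ n then F k n / n else 0) ^ 2 := by
    have : ∀ n₁ ∈ Sp m E k, ∑ n₂ ∈ Sp m E k, ∑ g ∈ M.divisors, (Nat.totient g : ℝ) *
        ((if g ∣ n₁ then F k n₁ / n₁ else 0) * (if g ∣ n₂ then F k n₂ / n₂ else 0)) =
        ∑ g ∈ M.divisors, ∑ n₂ ∈ Sp m E k, (Nat.totient g : ℝ) *
        ((if g ∣ n₁ then F k n₁ / n₁ else 0) * (if g ∣ n₂ then F k n₂ / n₂ else 0)) :=
      fun n₁ _ => Finset.sum_comm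
    rw [Finset.sum_congr rfl this, Finset.sum_comm]
    apply Finset.sum_congr rfl
    intro g _
    rw [sq, Finset.sum_mul_sum, Finset.mul_sum]
    apply Finset.sum_congr rfl
    intro n₁ _
    rw [Finset.mul_sum]
  have step4 : ∀ g ∈ M.divisors, (∑ n ∈ Sp m E k, if g ∣ n then F k n / n else 0) ≤
      F k g * ((2929 / 1000) / (p * g)) * Pf k := by
    intro g hg
    have hgd := (Nat.mem_divisors.1 hg).1
    have hg0 : 0 < g := Nat.pos_of_dvd_of_pos hgd hM0
    have hcg : Nat.Coprime p g := (hcop.coprime_dvd_left hgd).symm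
    have h1 := U_bound m k (p ^ 1 * g) hm (by have := hk.pos; positivity)
    rw [F_pow_mul hk (by omega)] at h1
    have h2 : (∑ n ∈ Sp m E k, if g ∣ n then F k n / n else 0) ≤ U m k (p ^ 1 * g) := by
      unfold U
      rw [← Finset.sum_filter]
      apply Finset.sum_le_sum_of_subset_of_nonneg
      · intro n hn
        rw [Finset.mem_filter] at hn ⊢
        have hn1 := Finset.mem_filter.1 hn.1
        refine ⟨hn1.1, ?_⟩
        rw [pow_one]
        exact hcg.mul_dvd_of_dvd_of_dvd hn1.2.1 hn.2
      · intro n _ _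
        exact div_nonneg (F_pos _ _).le (by positivity)
    refine h2.trans (h1.trans (le_of_eq ?_))
    push_cast
    rw [pow_one]
  have hS0 : ∀ g, 0 ≤ (∑ n ∈ Sp m E k, if g ∣ n then F k n / (n : ℝ) else 0) := by
    intro g
    apply Finset.sum_nonneg
    intro n _
    split_ifs
    · exact div_nonneg (F_pos _ _).le (by positivity)
    · exact le_rfl
  calc _ ≤ _ := step1
    _ ≤ ∑ n₁ ∈ Sp m E k, ∑ n₂ ∈ Sp m E k, ∑ g ∈ M.divisors, (Nat.totient g : ℝ) *
        ((if g ∣ n₁ then F k n₁ / n₁ else 0) * (if g ∣ n₂ then F k n₂ / n₂ else 0)) :=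
        Finset.sum_le_sum (fun n₁ h₁ => Finset.sum_le_sum (fun n₂ h₂ => step2 n₁ h₁ n₂ h₂))
    _ = _ := step3
    _ ≤ ∑ g ∈ M.divisors, (Nat.totient g : ℝ) * (F k g * ((2929 / 1000) / (p * g)) * Pf k) ^ 2 := by
        apply Finset.sum_le_sum
        intro g hg
        exact mul_le_mul_of_nonneg_left (pow_le_pow_left₀ (hS0 g) (step4 g hg) 2) (by positivity)
    _ = ((2929 / 1000) ^ 2 * Pf k ^ 2 / (p : ℝ) ^ 2) *
        ∑ g ∈ M.divisors, (Nat.totient g : ℝ) * F k g ^ 2 / (g : ℝ) ^ 2 := by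
        rw [Finset.mul_sum]
        apply Finset.sum_congr rfl
        intro g hg
        have hg0 : 0 < g := Nat.pos_of_dvd_of_pos (Nat.mem_divisors.1 hg).1 hM0
        have : (g : ℝ) ≠ 0 := by positivity
        field_simp
    _ ≤ ((2929 / 1000) ^ 2 * Pf k ^ 2 / (p : ℝ) ^ 2) * Gf k :=
        mul_le_mul_of_nonneg_left (G_bound E k) (by positivity)
    _ = _ := by ring

end CovTen

namespace CovTen

noncomputable def gfun (α : ℝ) : ℝ := if α ≤ 1 / 4 then 1 / (1 - α) else 4 / 3

lemma gfun_nonneg (α : ℝ) : 0 ≤ gfun α := by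
  unfold gfun
  split_ifs
  · apply div_nonneg <;> linarith
  · norm_num

lemma gfun_le {α : ℝ} : gfun α ≤ 4 / 3 := by
  unfold gfun
  split_ifs with h
  · rw [div_le_div_iff₀ (by linarith) (by norm_num)]; linarith
  · exact le_rfl

lemma gfun_mul_le {α : ℝ} : gfun α * (1 - α) ≤ 1 := by
  unfold gfun
  split_ifs with h
  · rw [one_div, inv_mul_cancel₀ (by linarith)]
  · linarith

lemma gfun_mul_ge {α : ℝ} : 1 - 4 / 3 * α ^ 2 ≤ gfun α * (1 - α) := by
  unfold gfun
  split_ifs with h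
  · rw [one_div, inv_mul_cancel₀ (by linarith)]; nlinarith [sq_nonneg α]
  · nlinarith [sq_nonneg (1 - 2 * α)]

lemma F_succ_not_dvd {k d : ℕ} (h : ¬ (k + 1) ∣ d) : F (k + 1) d = F k d := by
  rw [F, if_neg (fun h' => h h'.2.2), mul_one]

lemma per_of_dvd {f : ℤ → ℝ} {M N : ℕ} (h : M ∣ N) (hf : Function.Periodic f (M : ℤ)) :
    Function.Periodic f (N : ℤ) := by
  obtain ⟨t, rfl⟩ := h
  have := hf.nat_mul t
  push_cast
  rw [mul_comm]
  exact this

lemma Inv.step_prime {m N E : ℕ} {r : ℕ → ℤ} {k : ℕ} {w : ℤ → ℝ} {μ : ℝ} (hm : 0 < m)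
    (hk : (k + 1).Prime) (h29 : 29 ≤ k) (hN : Q E (k + 1) ∣ N) (hI : Inv m N E r k w μ) :
    ∃ w', Inv m N E r (k + 1) w'
      (μ - 4 / 3 * ((2929 / 1000) ^ 2 * (Pf k ^ 2 * Gf k) / ((k + 1 : ℕ) : ℝ) ^ 2)) := by
  have hM2 := second_moment hm hk hI
  have hQ := Q_succ_prime (E := E) hk
  have hcop : Nat.Coprime (Q E k) (k + 1) := Q_coprime E hk (by omega)
  have hq0 : 0 < (k + 1) ^ E := by positivity
  have hMN : Q E k ∣ N := (Q_dvd_succ E k).trans hN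
  have hBper := Bad_per m E k r
  set B := Bad m E k r with hB
  set α := Av (Q E k) ((k + 1) ^ E) B with hαdef
  have hαper : Function.Periodic α (Q E k : ℤ) := Av_per (by rw [← hQ]; exact hBper)
  set u : ℤ → ℝ := fun x => w x * gfun (α x) with hu
  have huper : Function.Periodic u (Q E k : ℤ) := by
    intro x
    simp only [hu]
    rw [hI.per, hαper]
  have hB1 : ∀ x, B x = 0 ∨ B x = 1 := by
    intro x
    rw [hB]; unfold Bad
    split_ifs
    · right; rfl
    · left; rfl
  have hAv1 : ∀ x, Av (Q E k) ((k + 1) ^ E) (fun x => 1 - B x) x = 1 - α x := by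
    intro x
    rw [hαdef]
    unfold Av
    rw [Finset.sum_sub_distrib, sub_div]
    have : (((k + 1) ^ E : ℕ) : ℝ) ≠ 0 := by positivity
    simp only [Finset.sum_const, Finset.card_range, nsmul_eq_mul, mul_one]
    rw [div_self this]
  set w' : ℤ → ℝ := fun x => u x * (1 - B x) with hw'
  have hu0 : ∀ x, 0 ≤ u x := fun x => mul_nonneg (hI.nonneg x) (gfun_nonneg _)
  have hAw' : ∀ x, Av (Q E k) ((k + 1) ^ E) w' x = u x * (1 - α x) := by
    intro x
    rw [hw', Av_mul huper, hAv1]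
  have hw'per : Function.Periodic w' (Q E (k + 1) : ℤ) := by
    intro x
    simp only [hw']
    rw [hBper, per_of_dvd (Q_dvd_succ E k) huper]
  have hw'le : ∀ x, w' x ≤ 4 / 3 * w x := by
    intro x
    have h1 : u x ≤ 4 / 3 * w x := by
      have := mul_le_mul_of_nonneg_left (gfun_le (α := α x)) (hI.nonneg x)
      simp only [hu]; linarith
    rcases hB1 x with h | h
    · simp only [hw', h]; linarith
    · simp only [hw', h]
      have := hI.nonneg x
      linarith
  refine ⟨w', ?_, hw'per, ?_, ?_, ?_⟩
  · intro x
    apply mul_nonneg (hu0 x)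
    rcases hB1 x with h | h <;> rw [h] <;> norm_num
  · intro n hn hd x hx
    by_cases hp : (k + 1) ∣ n
    · have : B x = 1 := by
        rw [hB]; unfold Bad
        rw [if_pos ⟨n, Finset.mem_filter.2 ⟨hn, hp, hd⟩, hx⟩]
      simp only [hw', this]; ring
    · have hd' : n ∣ Q E k := by
        rw [hQ] at hd
        apply Nat.Coprime.dvd_of_dvd_mul_right _ hd
        apply Nat.Coprime.pow_right
        rw [Nat.coprime_comm, Nat.Prime.coprime_iff_not_dvd hk]
        exact hp
      have := hI.zero n hn hd' x hx
      simp only [hw', hu, this]; ring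
  · intro d hd a
    obtain ⟨i, d', rfl, hd', hi⟩ := split_dvd hk hd
    have hnd : ¬ (k + 1) ∣ d' := by
      have := hcop.coprime_dvd_left hd'
      rw [Nat.coprime_comm, Nat.Prime.coprime_iff_not_dvd hk] at this
      exact this
    have hclsper : Function.Periodic (cls a ((k + 1) ^ i * d')) (N : ℤ) := cls_per a (hd.trans hN)
    rcases i with _ | i
    · rw [pow_zero, one_mul] at *
      rw [F_succ_not_dvd hnd]
      refine le_trans ?_ (hI.bd d' hd' a)
      have hp1 : Function.Periodic (fun x => w' x * cls a d' x) (N : ℤ) := by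
        intro x
        simp only
        rw [per_of_dvd hN hw'per, hclsper]
      rw [← mean_Av (M := Q E k) hq0 hp1]
      apply mean_mono
      intro x
      have e : (fun x => w' x * cls a d' x) = fun x => cls a d' x * w' x := by
        funext x; ring
      rw [e, Av_mul (cls_per a hd'), hAw', mul_comm]
      apply mul_le_mul_of_nonneg_right _ (cls_nonneg _ _ _)
      simp only [hu]
      rw [mul_assoc]
      exact mul_le_of_le_one_right (hI.nonneg x) gfun_mul_le
    · have hF : F (k + 1) ((k + 1) ^ (i + 1) * d') = 4 / 3 * F k d' := by
        rw [F, F_pow_mul hk (by omega), if_pos ⟨hk, by omega, (dvd_pow_self _ (by omega)).mul_right _⟩]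
        ring
      have hp1 : Function.Periodic (fun x => w x * cls a ((k + 1) ^ (i + 1) * d') x) (N : ℤ) := by
        intro x
        simp only
        rw [per_of_dvd hMN hI.per, hclsper]
      have hkey : mean N (fun x => w x * cls a ((k + 1) ^ (i + 1) * d') x) =
          (1 / ((k + 1 : ℕ) : ℝ) ^ (i + 1)) * mean N (fun x => w x * cls a d' x) := by
        rw [← mean_Av (M := Q E k) hq0 hp1, ← mean_const_mul]
        congr 1
        funext x
        rw [Av_mul hI.per, Av_cls a hk hcop hi hd']
        ring
      have h1 : mean N (fun x => w' x * cls a ((k + 1) ^ (i + 1) * d') x) ≤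
          4 / 3 * mean N (fun x => w x * cls a ((k + 1) ^ (i + 1) * d') x) := by
        rw [← mean_const_mul]
        apply mean_mono
        intro x
        rw [← mul_assoc]
        exact mul_le_mul_of_nonneg_right (hw'le x) (cls_nonneg _ _ _)
      refine h1.trans ?_
      rw [hkey, hF]
      have h2 := hI.bd d' hd' a
      have h3 : (0 : ℝ) ≤ 1 / ((k + 1 : ℕ) : ℝ) ^ (i + 1) := by positivity
      calc _ ≤ 4 / 3 * ((1 / ((k + 1 : ℕ) : ℝ) ^ (i + 1)) * (F k d' / d')) := by gcongr
        _ = _ := by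
          rw [Nat.cast_mul, Nat.cast_pow, div_mul_div_comm, one_mul, mul_div_assoc]
  · rw [← mean_Av (M := Q E k) hq0 (per_of_dvd hN hw'per)]
    have h1 : ∀ x, w x + (-(4 / 3)) * (w x * α x ^ 2) ≤ Av (Q E k) ((k + 1) ^ E) w' x := by
      intro x
      rw [hAw']
      have := mul_le_mul_of_nonneg_left (gfun_mul_ge (α := α x)) (hI.nonneg x)
      simp only [hu]
      linarith
    have h2 := mean_mono (N := N) h1
    rw [mean_add, mean_const_mul] at h2
    have := hI.mass
    linarith

lemma Inv.step_not_prime {m N E : ℕ} {r : ℕ → ℤ} {k : ℕ} {w : ℤ → ℝ} {μ : ℝ}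
    (hk : ¬ (k + 1).Prime) (hI : Inv m N E r k w μ) : Inv m N E r (k + 1) w μ := by
  have hQ : Q E (k + 1) = Q E k := by rw [Q, if_neg hk]
  have hF : ∀ n, F (k + 1) n = F k n := by
    intro n
    rw [F, if_neg (fun h => hk h.1), mul_one]
  refine ⟨hI.nonneg, ?_, ?_, ?_, hI.mass⟩
  · rw [hQ]; exact hI.per
  · rw [hQ]; exact hI.zero
  · rw [hQ]; intro d hd a; rw [hF]; exact hI.bd d hd a

/-- Accumulated loss. -/
noncomputable def Sr : ℕ → ℝ
  | 0 => 0
  | k + 1 => Sr k + (if (k + 1).Prime ∧ 29 < k + 1 then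
      (Pf k ^ 2 * Gf k) / ((k + 1 : ℕ) : ℝ) ^ 2 else 0)

lemma Inv.iterate {m N E : ℕ} {r : ℕ → ℤ} {w : ℤ → ℝ} {μ : ℝ} (hm : 0 < m)
    (hI : Inv m N E r 29 w μ) (k : ℕ) (hk : 29 ≤ k) (hN : Q E k ∣ N) :
    ∃ w', Inv m N E r k w' (μ - 4 / 3 * (2929 / 1000) ^ 2 * (Sr k - Sr 29)) := by
  induction k, hk using Nat.le_induction with
  | base => exact ⟨w, by simpa using hI⟩
  | succ k hk ih =>
    obtain ⟨w', hw'⟩ := ih ((Q_dvd_succ E k).trans hN)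
    by_cases hp : (k + 1).Prime
    · obtain ⟨w'', hw''⟩ := hw'.step_prime hm hp hk hN
      refine ⟨w'', ?_⟩
      convert hw'' using 1
      rw [Sr, if_pos ⟨hp, by omega⟩]
      ring
    · refine ⟨w', ?_⟩
      rw [Sr, if_neg (fun h => hp h.1), add_zero]
      exact hw'.step_not_prime hp

open Classical in
lemma Inv.base (m N E : ℕ) (r : ℕ → ℤ) (hN0 : 0 < N) (hN : Q E 29 ∣ N) :
    ∃ w, Inv m N E r 29 w
      (1 - ∑ n ∈ (Finset.Icc m (10 * m)).filter (fun n => n ∣ Q E 29), 1 / (n : ℝ)) := by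
  set S := (Finset.Icc m (10 * m)).filter (fun n => n ∣ Q E 29) with hS
  refine ⟨fun x => if ∃ n ∈ S, (n : ℤ) ∣ x - r n then 0 else 1, ?_, ?_, ?_, ?_, ?_⟩
  · intro x; split_ifs <;> norm_num
  · intro x
    simp only
    apply if_congr _ rfl rfl
    have key : ∀ n ∈ S, ((n : ℤ) ∣ x + (Q E 29 : ℤ) - r n ↔ (n : ℤ) ∣ x - r n) := by
      intro n hn
      have h1 : (n : ℤ) ∣ (Q E 29 : ℤ) := by
        exact_mod_cast (Finset.mem_filter.1 hn).2
      have : x + (Q E 29 : ℤ) - r n = (x - r n) + Q E 29 := by ring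
      rw [this]
      exact Int.dvd_add_left h1
    constructor
    · rintro ⟨n, hn, hd⟩; exact ⟨n, hn, (key n hn).1 hd⟩
    · rintro ⟨n, hn, hd⟩; exact ⟨n, hn, (key n hn).2 hd⟩
  · intro n hn hd x hx
    rw [if_pos ⟨n, Finset.mem_filter.2 ⟨hn, hd⟩, hx⟩]
  · intro d hd a
    rw [F_small d le_rfl, ← mean_cls N hN0 a d (hd.trans hN)]
    apply mean_mono
    intro x
    have := cls_nonneg a d x
    split_ifs <;> linarith
  · have h1 : ∀ x : ℤ, (1 : ℝ) ≤ (if ∃ n ∈ S, (n : ℤ) ∣ x - r n then 0 else 1) +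
        ∑ n ∈ S, cls (r n) n x := by
      intro x
      split_ifs with h
      · obtain ⟨n, hn, hd⟩ := h
        have h1 : cls (r n) n x = 1 := by unfold cls; rw [if_pos hd]
        have h2 := Finset.single_le_sum (f := fun n => cls (r n) n x) (fun n _ => cls_nonneg _ _ _) hn
        linarith
      · have := Finset.sum_nonneg (fun n (_ : n ∈ S) => cls_nonneg (r n) n x)
        linarith
    have h2 := mean_mono (N := N) h1
    rw [mean_one hN0, mean_add, mean_sum] at h2
    have h3 : ∑ n ∈ S, mean N (cls (r n) n) = ∑ n ∈ S, 1 / (n : ℝ) := by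
      apply Finset.sum_congr rfl
      intro n hn
      exact mean_cls N hN0 _ _ ((Finset.mem_filter.1 hn).2.trans hN)
    have h4 : ∑ n ∈ S, mean N (fun x => cls (r n) n x) = ∑ n ∈ S, 1 / (n : ℝ) := h3
    rw [h4] at h2
    linarith

lemma large_core (m : ℕ) (hm : 3 ≤ m) (r : ℕ → ℤ)
    (hlt : ∑ n ∈ (Finset.Icc m (10 * m)).filter (fun n => n ∣ Q (10 * m) 29), 1 / (n : ℝ) +
      4 / 3 * (2929 / 1000) ^ 2 * (Sr (10 * m) - Sr 29) < 1) :
    ∃ x : ℤ, ∀ n ∈ Finset.Icc m (10 * m), ¬ (n : ℤ) ∣ x - r n := by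
  have hN0 := Q_pos (10 * m) (10 * m)
  obtain ⟨w, hw⟩ := Inv.base m (Q (10 * m) (10 * m)) (10 * m) r hN0 (Q_dvd (by omega))
  obtain ⟨w', hw'⟩ := hw.iterate (by omega) (10 * m) (by omega) dvd_rfl
  by_contra hcon
  push Not at hcon
  have hz : ∀ x, w' x = 0 := by
    intro x
    obtain ⟨n, hn, hd⟩ := hcon x
    have := Finset.mem_Icc.1 hn
    exact hw'.zero n hn (dvd_Q (by omega) (by omega) (by omega)) x hd
  have := hw'.mass
  have h0 : mean (Q (10 * m) (10 * m)) w' = 0 := by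
    unfold mean
    simp [hz]
  linarith

end CovTen

namespace CovTen

/-! ### Numerical estimates for large `m` -/

/-- Lower bound, in units of `10 ^ (-9)`, for the sum of `1/n` over divisors `n ≤ hi` of `L`. -/
def sumDivLow (L hi : ℕ) : ℕ → ℕ → ℕ
  | 0, a => cond (Nat.ble a hi) (cond (Nat.beq (L % a) 0) (1000000000 / a) 0) 0
  | k + 1, a => cond (Nat.ble a hi) (sumDivLow L hi k a + sumDivLow L hi k (a + 2 ^ k)) 0

lemma fix_le_inv {n : ℕ} (hn : 0 < n) :
    ((1000000000 / n : ℕ) : ℝ) / 1000000000 ≤ 1 / (n : ℝ) := by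
  have h : n * (1000000000 / n) ≤ 1000000000 := Nat.mul_div_le _ _
  have h' : (n : ℝ) * ((1000000000 / n : ℕ) : ℝ) ≤ 1000000000 := by exact_mod_cast h
  rw [div_le_div_iff₀ (by norm_num) (by positivity)]
  linarith

lemma sumDivLow_spec (L hi : ℕ) (k a : ℕ) (ha : 0 < a) :
    (sumDivLow L hi k a : ℝ) / 1000000000 ≤
    ∑ n ∈ Finset.Ico a (a + 2 ^ k), (if n ≤ hi ∧ n ∣ L then 1 / (n : ℝ) else 0) := by
  induction k generalizing a with
  | zero =>
    simp only [pow_zero, Nat.Ico_succ_singleton, Finset.sum_singleton]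
    by_cases h1 : a ≤ hi
    · by_cases h2 : a ∣ L
      · have h1' : Nat.ble a hi = true := by simpa using h1
        have h2' : Nat.beq (L % a) 0 = true := by simp [Nat.mod_eq_zero_of_dvd h2]
        unfold sumDivLow
        rw [h1', h2', if_pos ⟨h1, h2⟩]
        exact fix_le_inv ha
      · have h1' : Nat.ble a hi = true := by simpa using h1
        have h2' : Nat.beq (L % a) 0 = false := by
          rw [Bool.eq_false_iff]
          intro h
          exact h2 (Nat.dvd_of_mod_eq_zero (Nat.eq_of_beq_eq_true h))
        unfold sumDivLow
        rw [h1', h2', if_neg (fun h => h2 h.2)]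
        simp
    · have h1' : Nat.ble a hi = false := by
        rw [Bool.eq_false_iff]; simpa using h1
      unfold sumDivLow
      rw [h1', if_neg (fun h => h1 h.1)]
      simp
  | succ k ih =>
    by_cases h : a ≤ hi
    · have h1 : Nat.ble a hi = true := by simpa using h
      unfold sumDivLow
      rw [h1]
      have := ih a ha
      have := ih (a + 2 ^ k) (by positivity)
      simp only [cond_true]
      rw [← Finset.sum_Ico_consecutive _ (Nat.le_add_right a (2 ^ k))
        (by rw [pow_succ]; omega)]
      push_cast
      rw [add_div]
      have e : a + 2 ^ (k + 1) = a + 2 ^ k + 2 ^ k := by rw [pow_succ]; ring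
      rw [e]
      linarith
    · have h1 : Nat.ble a hi = false := by
        rw [Bool.eq_false_iff]; simpa using h
      unfold sumDivLow
      rw [h1]
      simp only [cond_false, Nat.cast_zero, zero_div]
      apply Finset.sum_nonneg
      intro n _
      split_ifs <;> positivity

lemma low_val : 6091410428 ≤ sumDivLow (6469693230 ^ 12) 4581 13 1 := by
  decide +kernel

lemma Rf_val : Rf 29 ≤ 633123 / 100000 := by
  norm_num [Rf]

lemma smooth_tail (m : ℕ) (hm : 4582 ≤ m) :
    ∑ n ∈ (Finset.Icc m (10 * m)).filter (fun n => n ∣ Q (10 * m) 29), 1 / (n : ℝ) ≤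
      24 / 100 := by
  have hR := R_bound (10 * m) 29
  have hRv := Rf_val
  have hlow := sumDivLow_spec (6469693230 ^ 12) 4581 13 1 one_pos
  have hlv : (6091410428 : ℝ) ≤ (sumDivLow (6469693230 ^ 12) 4581 13 1 : ℝ) := by
    exact_mod_cast low_val
  rw [← Finset.sum_filter] at hlow
  set T := (Finset.Ico 1 (1 + 2 ^ 13)).filter (fun n => n ≤ 4581 ∧ n ∣ 6469693230 ^ 12) with hT
  set S := (Finset.Icc m (10 * m)).filter (fun n => n ∣ Q (10 * m) 29) with hS
  have hdis : Disjoint S T := by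
    rw [Finset.disjoint_left]
    intro n h1 h2
    have := (Finset.mem_Icc.1 (Finset.mem_filter.1 h1).1).1
    have := (Finset.mem_filter.1 h2).2.1
    omega
  have hsub : S ∪ T ⊆ (Q (10 * m) 29).divisors := by
    intro n hn
    rw [Nat.mem_divisors]
    refine ⟨?_, (Q_pos _ _).ne'⟩
    rcases Finset.mem_union.1 hn with h | h
    · exact (Finset.mem_filter.1 h).2
    · obtain ⟨h0, h1, h2⟩ := Finset.mem_filter.1 h
      have hn0 : 0 < n := (Finset.mem_Ico.1 h0).1
      rw [Nat.dvd_iff_prime_pow_dvd_dvd]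
      intro p j hp hj
      rcases j with _ | j
      · simp
      have h3 : p ^ (j + 1) ≤ n := Nat.le_of_dvd hn0 hj
      have h4 : j + 1 < p ^ (j + 1) := Nat.lt_pow_self hp.one_lt
      have h5 : p ∣ 6469693230 ^ 12 := ((dvd_pow_self p (by omega)).trans hj).trans h2
      have h6 : p ∣ Nat.factorial 29 :=
        (hp.dvd_of_dvd_pow h5).trans (by norm_num [Nat.factorial])
      exact (pow_dvd_pow p (by omega)).trans
        (pow_dvd_Q (10 * m) hp ((Nat.Prime.dvd_factorial hp).1 h6))
  have h1 : ∑ n ∈ S ∪ T, 1 / (n : ℝ) ≤ ∑ g ∈ (Q (10 * m) 29).divisors, 1 / (g : ℝ) :=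
    Finset.sum_le_sum_of_subset_of_nonneg hsub (fun _ _ _ => by positivity)
  rw [Finset.sum_union hdis] at h1
  have h2 : (6091410428 : ℝ) / 1000000000 ≤ ∑ n ∈ T, 1 / (n : ℝ) :=
    le_trans (by gcongr) hlow
  linarith

/-- The quantity governing the second moments. -/
noncomputable def Vf (k : ℕ) : ℝ := Pf k ^ 2 * Gf k

lemma Vf_pos (k : ℕ) : 0 < Vf k := by
  unfold Vf
  have := Pf_one_le k
  have := Gf_pos k
  positivity

lemma Vf_succ {k : ℕ} (hk : 29 ≤ k) : Vf (k + 1) = Vf k * (if (k + 1).Prime then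
    (1 + 1 / (3 * ((k + 1 : ℕ) : ℝ))) ^ 2 * (1 + 16 / (9 * ((k + 1 : ℕ) : ℝ))) else 1) := by
  unfold Vf
  rw [Pf, Gf]
  by_cases hp : (k + 1).Prime
  · rw [if_pos ⟨hp, by omega⟩, if_pos hp, if_pos (by omega), if_pos hp]; ring
  · rw [if_neg (fun h => hp h.1), if_neg hp, if_neg hp]; ring

lemma Sr_succ {k : ℕ} (hk : 29 ≤ k) : Sr (k + 1) = Sr k + (if (k + 1).Prime then
    Vf k / ((k + 1 : ℕ) : ℝ) ^ 2 else 0) := by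
  rw [Sr]
  by_cases hp : (k + 1).Prime
  · rw [if_pos ⟨hp, by omega⟩, if_pos hp, Vf]
  · rw [if_neg (fun h => hp h.1), if_neg hp]

lemma Sr_small {k : ℕ} (hk : k ≤ 29) : Sr k = 0 := by
  induction k with
  | zero => rw [Sr]
  | succ k ih => rw [Sr, ih (by omega), if_neg (by omega)]; norm_num

lemma Sr_mono : Monotone Sr := by
  apply monotone_nat_of_le_succ
  intro k
  rw [Sr]
  have := Vf_pos k
  unfold Vf at this
  split_ifs
  · have : 0 ≤ (Pf k ^ 2 * Gf k) / ((k + 1 : ℕ) : ℝ) ^ 2 := by positivity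
    linarith
  · linarith

lemma Vf_val : Vf 29 ≤ 3876886385230 / 1000000000000 := by
  unfold Vf
  rw [Pf_small le_rfl]
  norm_num [Gf]

/-- Forces evaluation of a natural number. -/
def force {α : Type} (n : ℕ) (f : ℕ → α) : α :=
  match n with
  | 0 => f 0
  | n + 1 => f (n + 1)

lemma force_eq {α : Type} (n : ℕ) (f : ℕ → α) : force n f = f n := by
  cases n <;> rfl

/-- Over-approximate primality test. -/
def maybePrime (q : ℕ) : Bool :=
  cond (Nat.ble q 71) (Nat.beq (Nat.gcd q 5040) 1)
    (Nat.beq (Nat.gcd q 850478588567862317521167644239926010288584608120796235886430763388588680378079017697280000000000000000) 1)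

lemma maybePrime_of_prime {q : ℕ} (hq : q.Prime) (h : 29 < q) : maybePrime q = true := by
  have key : ∀ n, n < q → Nat.beq (Nat.gcd q (Nat.factorial n)) 1 = true := by
    intro n hn
    have : Nat.Coprime q (Nat.factorial n) := by
      rw [Nat.Prime.coprime_iff_not_dvd hq, Nat.Prime.dvd_factorial hq]; omega
    have h0 : Nat.gcd q (Nat.factorial n) = 1 := this
    rw [h0]
    rfl
  have h1 := key 7 (by omega)
  unfold maybePrime
  by_cases h71 : q ≤ 71
  · have : Nat.ble q 71 = true := by simpa using h71
    rw [this]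
    exact h1
  · have : Nat.ble q 71 = false := by rw [Bool.eq_false_iff]; simpa using h71
    rw [this]
    have h2 := key 71 (by omega)
    have e : Nat.factorial 71 = 850478588567862317521167644239926010288584608120796235886430763388588680378079017697280000000000000000 := by
      norm_num [Nat.factorial]
    rw [e] at h2
    exact h2

/-- Fixed point evaluation of `Vf` and `Sr` in units of `10 ^ (-12)`. -/
def loop (vb sb : ℕ) : ℕ → ℕ → ℕ → ℕ → Bool
  | 0, _, v, s => Nat.ble v vb && Nat.ble s sb
  | n + 1, k, v, s => cond (maybePrime (k + 1))
      (force (s + v / ((k + 1) * (k + 1)) + 1) fun s' =>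
        force (v * ((3 * (k + 1) + 1) ^ 2 * (9 * (k + 1) + 16)) / (81 * (k + 1) ^ 3) + 1) fun v' =>
          force (k + 1) fun k' => loop vb sb n k' v' s')
      (force (k + 1) fun k' => loop vb sb n k' v s)

lemma div_fix (a b : ℕ) (hb : 0 < b) : (a : ℝ) / b ≤ ((a / b + 1 : ℕ) : ℝ) := by
  have h : a < b * (a / b + 1) := Nat.lt_mul_div_succ _ hb
  have h' : (a : ℝ) < b * ((a / b + 1 : ℕ) : ℝ) := by exact_mod_cast h
  rw [div_le_iff₀ (by positivity)]
  linarith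

lemma loop_spec {vb sb : ℕ} (n k v s : ℕ) (hk : 29 ≤ k) (h : loop vb sb n k v s = true)
    (hv : Vf k ≤ (v : ℝ) / 1000000000000) (hs : Sr k ≤ (s : ℝ) / 1000000000000) :
    Vf (k + n) ≤ (vb : ℝ) / 1000000000000 ∧ Sr (k + n) ≤ (sb : ℝ) / 1000000000000 := by
  induction n generalizing k v s with
  | zero =>
    unfold loop at h
    simp only [Bool.and_eq_true, Nat.ble_eq] at h
    have h1 : (v : ℝ) ≤ vb := by exact_mod_cast h.1
    have h2 : (s : ℝ) ≤ sb := by exact_mod_cast h.2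
    refine ⟨hv.trans ?_, hs.trans ?_⟩ <;> gcongr
  | succ n ih =>
    unfold loop at h
    simp only [force_eq] at h
    have e : k + (n + 1) = (k + 1) + n := by ring
    rw [e]
    have hV := Vf_pos k
    have hS : 0 ≤ Sr k := by
      have := Sr_mono (Nat.zero_le k); rwa [Sr_small (by norm_num : 0 ≤ 29)] at this
    cases hm : maybePrime (k + 1) with
    | false =>
      rw [hm] at h
      have hp : ¬ (k + 1).Prime := by
        intro hp
        rw [maybePrime_of_prime hp (by omega)] at hm
        exact absurd hm (by decide)
      apply ih (k + 1) v s (by omega) h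
      · rw [Vf_succ hk, if_neg hp, mul_one]; exact hv
      · rw [Sr_succ hk, if_neg hp, add_zero]; exact hs
    | true =>
      rw [hm] at h
      have hq : (0 : ℝ) < ((k + 1 : ℕ) : ℝ) := by positivity
      apply ih (k + 1) _ _ (by omega) h
      · have h1 := div_fix (v * ((3 * (k + 1) + 1) ^ 2 * (9 * (k + 1) + 16))) (81 * (k + 1) ^ 3)
          (by positivity)
        rw [le_div_iff₀ (by norm_num)]
        refine le_trans ?_ h1
        rw [Vf_succ hk]
        set q : ℝ := ((k + 1 : ℕ) : ℝ) with hqd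
        have hfac : (if (k + 1).Prime then
            (1 + 1 / (3 * q)) ^ 2 * (1 + 16 / (9 * q)) else 1) ≤
            (3 * q + 1) ^ 2 * (9 * q + 16) / (81 * q ^ 3) := by
          have e1 : (3 * q + 1) ^ 2 * (9 * q + 16) / (81 * q ^ 3) =
            (1 + 1 / (3 * q)) ^ 2 * (1 + 16 / (9 * q)) := by
            field_simp
            norm_num
          rw [e1]
          split_ifs
          · exact le_rfl
          · have a1 : 1 ≤ 1 + 1 / (3 * q) := by
              have : 0 ≤ 1 / (3 * q) := by positivity
              linarith
            have a2 : 1 ≤ 1 + 16 / (9 * q) := by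
              have : 0 ≤ 16 / (9 * q) := by positivity
              linarith
            exact one_le_mul_of_one_le_of_one_le (one_le_pow₀ a1) a2
        have e2 : ((v * ((3 * (k + 1) + 1) ^ 2 * (9 * (k + 1) + 16)) : ℕ) : ℝ) /
            ((81 * (k + 1) ^ 3 : ℕ) : ℝ) = v * ((3 * q + 1) ^ 2 * (9 * q + 16) / (81 * q ^ 3)) := by
          rw [hqd]; push_cast; ring
        rw [e2]
        have hv' : Vf k * 1000000000000 ≤ v := by
          rwa [le_div_iff₀ (by norm_num)] at hv
        calc _ = (Vf k * 1000000000000) * (if (k + 1).Prime then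
            (1 + 1 / (3 * q)) ^ 2 * (1 + 16 / (9 * q)) else 1) := by ring
          _ ≤ (Vf k * 1000000000000) * ((3 * q + 1) ^ 2 * (9 * q + 16) / (81 * q ^ 3)) := by
            gcongr
          _ ≤ _ := by gcongr
      · have h1 := div_fix v ((k + 1) * (k + 1)) (by positivity)
        rw [le_div_iff₀ (by norm_num)] at hs hv ⊢
        have h2 : (v : ℝ) / (((k + 1) * (k + 1) : ℕ) : ℝ) = v / ((k + 1 : ℕ) : ℝ) ^ 2 := by
          push_cast; ring
        rw [h2] at h1
        have h3 : (if (k + 1).Prime then Vf k / ((k + 1 : ℕ) : ℝ) ^ 2 else 0) * 1000000000000 ≤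
            v / ((k + 1 : ℕ) : ℝ) ^ 2 := by
          split_ifs
          · rw [div_mul_eq_mul_div]; gcongr
          · rw [zero_mul]; positivity
        have h4 : ((s + v / ((k + 1) * (k + 1)) + 1 : ℕ) : ℝ) =
            (s : ℝ) + ((v / ((k + 1) * (k + 1)) + 1 : ℕ) : ℝ) := by
          rw [add_assoc, Nat.cast_add]
        rw [Sr_succ hk, add_mul, h4]
        linarith

lemma loop_600 : loop 16154979331735 42908577864 571 29 3876886385230 0 = true := by
  decide +kernel

lemma loop_1300 : loop 21326807657626 45345736128 700 600 16154979331735 42908577864 = true := by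
  decide +kernel

lemma loop_2000 : loop 24495503352610 46152395393 700 1300 21326807657626 45345736128 = true := by
  decide +kernel

lemma loop_2750 : loop 27109555498683 46607855107 750 2000 24495503352610 46152395393 = true := by
  decide +kernel

lemma loop_3500 : loop 29049462374384 46863754375 750 2750 27109555498683 46607855107 = true := by
  decide +kernel

lemma loop_4250 : loop 30814611155341 47051562033 750 3500 29049462374384 46863754375 = true := by
  decide +kernel

lemma loop_4998 : loop 32250217118463 47178987819 748 4250 30814611155341 47051562033 = true := by
  decide +kernel

lemma VS_val : Vf 4998 ≤ ((32250217118463 : ℕ) : ℝ) / 1000000000000 ∧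
    Sr 4998 ≤ ((47178987819 : ℕ) : ℝ) / 1000000000000 := by
  have h0 : Vf 29 ≤ ((3876886385230 : ℕ) : ℝ) / 1000000000000 := by exact_mod_cast Vf_val
  have s0 : Sr 29 ≤ ((0 : ℕ) : ℝ) / 1000000000000 := by rw [Sr_small le_rfl]; norm_num
  have a600 := loop_spec _ 29 _ _ (by norm_num) loop_600 h0 s0
  have a1300 := loop_spec _ 600 _ _ (by norm_num) loop_1300 a600.1 a600.2
  have a2000 := loop_spec _ 1300 _ _ (by norm_num) loop_2000 a1300.1 a1300.2
  have a2750 := loop_spec _ 2000 _ _ (by norm_num) loop_2750 a2000.1 a2000.2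
  have a3500 := loop_spec _ 2750 _ _ (by norm_num) loop_3500 a2750.1 a2750.2
  have a4250 := loop_spec _ 3500 _ _ (by norm_num) loop_4250 a3500.1 a3500.2
  have a4998 := loop_spec _ 4250 _ _ (by norm_num) loop_4998 a4250.1 a4250.2
  exact a4998

/-- One step in the tail. -/
lemma tail_step {a : ℝ} {k : ℕ} (ha : 4998 ≤ a) (hk : a ≤ (k : ℝ)) :
    Vf (k + 1) ≤ Vf k * (1 + 245 / 100 / a) ∧ Sr (k + 1) ≤ Sr k + Vf k / a ^ 2 := by
  have hk29 : 29 ≤ k := by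
    have : (29 : ℝ) ≤ k := by linarith
    exact_mod_cast this
  have hV := Vf_pos k
  have ha0 : 0 < a := by linarith
  have hq : a ≤ ((k + 1 : ℕ) : ℝ) := by push_cast; linarith
  set q : ℝ := ((k + 1 : ℕ) : ℝ)
  constructor
  · rw [Vf_succ hk29]
    apply mul_le_mul_of_nonneg_left _ hV.le
    have h0 : 0 ≤ 245 / 100 / a := by positivity
    split_ifs
    · have h1 : (1 + 1 / (3 * q)) ^ 2 * (1 + 16 / (9 * q)) ≤
          (1 + 1 / (3 * a)) ^ 2 * (1 + 16 / (9 * a)) := by gcongr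
      refine h1.trans ?_
      set t := 1 / a with ht
      have ht0 : 0 ≤ t := by positivity
      have ht1 : t ≤ 1 / 4998 := by rw [ht]; gcongr
      have e1 : 1 / (3 * a) = t / 3 := by rw [ht]; field_simp
      have e2 : 16 / (9 * a) = 16 / 9 * t := by rw [ht]; field_simp
      have e3 : 245 / 100 / a = 245 / 100 * t := by rw [ht]; field_simp
      rw [e1, e2, e3]
      nlinarith [mul_nonneg ht0 ht0, mul_nonneg (mul_nonneg ht0 ht0) ht0,
        mul_le_mul_of_nonneg_left ht1 ht0, mul_le_mul_of_nonneg_left ht1 (mul_nonneg ht0 ht0)]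
    · linarith
  · rw [Sr_succ hk29]
    split_ifs
    · have : Vf k / q ^ 2 ≤ Vf k / a ^ 2 := by gcongr
      linarith
    · have : 0 ≤ Vf k / a ^ 2 := by positivity
      linarith

lemma comp_step {k : ℕ} (hk : 29 ≤ k) (h : ¬ (k + 1).Prime) :
    Vf (k + 1) = Vf k ∧ Sr (k + 1) = Sr k := by
  rw [Vf_succ hk, Sr_succ hk, if_neg h, if_neg h]
  simp

lemma not_prime_of_dvd {k d : ℕ} (h : d ∣ k) (h1 : 1 < d) (h2 : d < k) : ¬ k.Prime := by
  intro hp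
  rcases (Nat.dvd_prime hp).1 h with h | h <;> omega

lemma tail_six {j : ℕ} (hj : 833 ≤ j) :
    Sr (6 * (j + 1)) + Vf (6 * (j + 1)) * (19 / 10) / ((6 * (j + 1) : ℕ) : ℝ) ≤
      Sr (6 * j) + Vf (6 * j) * (19 / 10) / ((6 * j : ℕ) : ℝ) := by
  set k := 6 * j with hkd
  have hk : 4998 ≤ k := by omega
  have e : 6 * (j + 1) = k + 6 := by omega
  rw [e]
  have hkr : (4998 : ℝ) ≤ (k : ℝ) := by exact_mod_cast hk
  have ha0 : (0 : ℝ) < k := by linarith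
  obtain ⟨v1, s1⟩ := tail_step (a := (k : ℝ)) (k := k) hkr le_rfl
  obtain ⟨v2, s2⟩ := comp_step (k := k + 1) (by omega)
    (not_prime_of_dvd (d := 2) (by omega) (by omega) (by omega))
  obtain ⟨v3, s3⟩ := comp_step (k := k + 2) (by omega)
    (not_prime_of_dvd (d := 3) (by omega) (by omega) (by omega))
  obtain ⟨v4, s4⟩ := comp_step (k := k + 3) (by omega)
    (not_prime_of_dvd (d := 2) (by omega) (by omega) (by omega))
  obtain ⟨v5, s5⟩ := tail_step (a := (k : ℝ)) (k := k + 4) hkr (by push_cast; linarith)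
  obtain ⟨v6, s6⟩ := comp_step (k := k + 5) (by omega)
    (not_prime_of_dvd (d := 2) (by omega) (by omega) (by omega))
  simp only [add_assoc, Nat.reduceAdd] at *
  rw [v4, v3, v2] at v5 s5
  rw [s4, s3, s2] at s5
  rw [v6, s6]
  have hV := Vf_pos k
  set V := Vf k
  set a : ℝ := (k : ℝ)
  have hμ : 0 < 1 + 245 / 100 / a := by positivity
  have hv5 : Vf (k + 5) ≤ V * (1 + 245 / 100 / a) ^ 2 := by
    calc Vf (k + 5) ≤ Vf (k + 1) * (1 + 245 / 100 / a) := v5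
      _ ≤ V * (1 + 245 / 100 / a) * (1 + 245 / 100 / a) := by gcongr
      _ = _ := by ring
  have hs5 : Sr (k + 5) ≤ Sr k + V / a ^ 2 + V * (1 + 245 / 100 / a) / a ^ 2 := by
    have : Vf (k + 1) / a ^ 2 ≤ V * (1 + 245 / 100 / a) / a ^ 2 := by gcongr
    linarith
  have hk6 : ((k + 6 : ℕ) : ℝ) = a + 6 := by push_cast; rfl
  rw [hk6]
  have h7 : Vf (k + 5) * (19 / 10) / (a + 6) ≤
      V * (1 + 245 / 100 / a) ^ 2 * (19 / 10) / (a + 6) := by gcongr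
  have h8 : 1 / a ^ 2 + (1 + 245 / 100 / a) / a ^ 2 +
      (1 + 245 / 100 / a) ^ 2 * (19 / 10) / (a + 6) ≤ (19 / 10) / a := by
    have e1 : 1 / a ^ 2 + (1 + 245 / 100 / a) / a ^ 2 +
      (1 + 245 / 100 / a) ^ 2 * (19 / 10) / (a + 6) =
      ((2 * a + 245 / 100) * (a + 6) + (a + 245 / 100) ^ 2 * (19 / 10) * a) /
        (a ^ 3 * (a + 6)) := by
      field_simp; ring
    rw [e1, div_le_div_iff₀ (by positivity) ha0]
    have : ((2 * a + 245 / 100) * (a + 6) + (a + 245 / 100) ^ 2 * (19 / 10) * a) ≤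
      19 / 10 * (a ^ 2 * (a + 6)) := by nlinarith
    calc _ ≤ 19 / 10 * (a ^ 2 * (a + 6)) * a := by gcongr
      _ = _ := by ring
  have h9 := mul_le_mul_of_nonneg_left h8 hV.le
  have e9 : V * (1 / a ^ 2 + (1 + 245 / 100 / a) / a ^ 2 +
      (1 + 245 / 100 / a) ^ 2 * (19 / 10) / (a + 6)) =
      V / a ^ 2 + V * (1 + 245 / 100 / a) / a ^ 2 +
      V * (1 + 245 / 100 / a) ^ 2 * (19 / 10) / (a + 6) := by ring
  have e10 : V * (19 / 10 / a) = V * (19 / 10) / a := by ring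
  rw [e9, e10] at h9
  linarith

lemma Sr_bound (k : ℕ) : Sr k ≤ 5944 / 100000 := by
  have h : ∀ j, 833 ≤ j → Sr (6 * j) + Vf (6 * j) * (19 / 10) / ((6 * j : ℕ) : ℝ) ≤
      5944 / 100000 := by
    intro j hj
    induction j, hj using Nat.le_induction with
    | base =>
      obtain ⟨h1, h2⟩ := VS_val
      norm_num at h1 h2 ⊢
      linarith
    | succ j hj ih => exact (tail_six hj).trans ih
  have h1 := h (k + 833) (by omega)
  have h2 : Sr k ≤ Sr (6 * (k + 833)) := Sr_mono (by omega)
  have h3 : 0 ≤ Vf (6 * (k + 833)) * (19 / 10) / ((6 * (k + 833) : ℕ) : ℝ) := by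
    have := Vf_pos (6 * (k + 833))
    positivity
  linarith

lemma large_range {m : ℕ} (hm : 4582 ≤ m) {C : Finset (ℤ × ℕ)} (hC : Covers C)
    (hrange : ∀ c ∈ C, m ≤ c.2 ∧ c.2 ≤ 10 * m)
    (hdist : ∀ c ∈ C, ∀ c' ∈ C, c ≠ c' → c.2 ≠ c'.2) : False := by
  classical
  let r : ℕ → ℤ := fun n => if h : ∃ c ∈ C, c.2 = n then (Classical.choose h).1 else 0
  have hr : ∀ c ∈ C, r c.2 = c.1 := by
    intro c hc
    have h : ∃ c' ∈ C, c'.2 = c.2 := ⟨c, hc, rfl⟩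
    have h1 : r c.2 = (Classical.choose h).1 := dif_pos h
    obtain ⟨h2, h3⟩ := Classical.choose_spec h
    rw [h1]
    by_contra hne
    exact hdist _ h2 c hc (fun heq => hne (by rw [heq])) h3
  have hlt := smooth_tail m hm
  have hS := Sr_bound (10 * m)
  obtain ⟨x, hx⟩ := large_core m (by omega) r (by
    rw [Sr_small (le_refl 29)]
    linarith)
  obtain ⟨c, hc, hd⟩ := hC x
  have := hrange c hc
  apply hx c.2 (Finset.mem_Icc.2 this)
  rw [hr c hc]
  exact hd

end CovTen

theorem no_distinct_covering_in_m_ten_m (m : ℕ) (hm : 3 ≤ m) :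
    ¬ ∃ C : Finset (ℤ × ℕ), IsDistinctCoveringSystem C ∧ ∀ c ∈ C, m ≤ c.2 ∧ c.2 ≤ 10 * m := by
  rintro ⟨C, ⟨⟨_, hcov⟩, _, hdist⟩, hrange⟩
  have hC : CovTen.Covers C := by
    intro x
    obtain ⟨c, hc, h⟩ := hcov x
    exact ⟨c, hc, h.symm.dvd⟩
  have hd : ∀ c ∈ C, ∀ c' ∈ C, c ≠ c' → c.2 ≠ c'.2 := hdist
  rcases Nat.lt_or_ge 66 m with h1 | h1
  · rcases Nat.lt_or_ge 4581 m with h2 | h2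
    · exact CovTen.large_range h2 hC hrange hd
    · exact CovTen.mid_range h1 h2 hC hrange hd
  · exact CovTen.small_range hm h1 hC hrange hd
end

section
/- If a distinct covering system has least modulus equal to 3, then its largest modulus is at least 36. -/
/-- `x` is covered by one of the classes `f n (mod n)`, `n ∈ S`. -/
def CoveredByModuli (f : ℕ → ℤ) (S : Finset ℕ) (x : ℤ) : Prop := ∃ n ∈ S, (n : ℤ) ∣ x - f n

theorem dvd_of_shift {n M p : ℕ} (hn : 0 < n) (h : p ∣ n / Nat.gcd n M) {d : ℤ}
    (hd : (n : ℤ) ∣ (M : ℤ) * d) : (p : ℤ) ∣ d := by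
  have h1 : n ∣ M * d.natAbs := by
    have := Int.natAbs_dvd_natAbs.mpr hd
    simpa [Int.natAbs_mul] using this
  have hg : 0 < Nat.gcd n M := Nat.gcd_pos_of_pos_left _ hn
  have h2 : n / Nat.gcd n M ∣ (M / Nat.gcd n M) * d.natAbs := by
    have e : M / Nat.gcd n M * d.natAbs = (M * d.natAbs) / Nat.gcd n M :=
      (Nat.div_mul_right_comm (Nat.gcd_dvd_right n M) d.natAbs)
    rw [e]
    exact Nat.div_dvd_div (Nat.gcd_dvd_left n M) h1
  have h3 := (Nat.coprime_div_gcd_div_gcd hg).dvd_of_dvd_mul_left h2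
  exact Int.natCast_dvd.mpr (h.trans h3)

/-- If `x` is not covered by `P` (of period `M`) nor by the moduli of `S` (dividing `M`), then the
translates `x + M t` are covered by different elements of `T`. -/
theorem key_shift (f : ℕ → ℤ) (S T : Finset ℕ) (P : ℤ → Prop) (p M : ℕ)
    (hP : ∀ x t : ℤ, P (x + M * t) → P x)
    (hcov : ∀ x, P x ∨ CoveredByModuli f (S ∪ T) x)
    (hS : ∀ n ∈ S, n ∣ M) (hT : ∀ n ∈ T, 0 < n ∧ p ∣ n / Nat.gcd n M)
    (x : ℤ) (hx : ¬ (P x ∨ CoveredByModuli f S x)) :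
    p ≤ T.card ∧ (T.card = p → ∀ n ∈ T, ((Nat.gcd n M : ℕ) : ℤ) ∣ x - f n) := by
  have h1 : ∀ t : ℕ, ∃ n ∈ T, (n : ℤ) ∣ x + M * t - f n := by
    intro t
    rcases hcov (x + M * t) with h | ⟨n, hn, h⟩
    · exact absurd (Or.inl (hP x t h)) hx
    · rcases Finset.mem_union.mp hn with hn | hn
      · exfalso
        apply hx
        refine Or.inr ⟨n, hn, ?_⟩
        have h2 : (n : ℤ) ∣ M * t := Dvd.dvd.mul_right (Int.natCast_dvd_natCast.mpr (hS n hn)) _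
        have h3 := Int.dvd_sub h h2
        have e : x + M * t - f n - M * t = x - f n := by ring
        rwa [e] at h3
      · exact ⟨n, hn, h⟩
  choose g hgT hg using h1
  have hinj : Set.InjOn g (Finset.range p : Set ℕ) := by
    intro a ha b hb hab
    have h2 := hg a
    have h3 := hg b
    rw [hab] at h2
    have h4 := Int.dvd_sub h2 h3
    have e : x + M * (a : ℤ) - f (g b) - (x + M * (b : ℤ) - f (g b)) = M * ((a : ℤ) - b) := by ring
    rw [e] at h4
    have h5 := dvd_of_shift (hT _ (hgT b)).1 (hT _ (hgT b)).2 h4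
    have ha' : a < p := by simpa using ha
    have hb' : b < p := by simpa using hb
    have h6 := Int.eq_zero_of_abs_lt_dvd h5 (by rw [abs_lt]; omega)
    omega
  have hcard : ((Finset.range p).image g).card = p := by
    rw [Finset.card_image_of_injOn hinj, Finset.card_range]
  have hsub : (Finset.range p).image g ⊆ T := by
    intro n hn
    obtain ⟨t, _, rfl⟩ := Finset.mem_image.mp hn
    exact hgT t
  refine ⟨hcard ▸ Finset.card_le_card hsub, ?_⟩
  intro hc n hn
  have heq := Finset.eq_of_subset_of_card_le hsub (by omega)
  rw [← heq] at hn
  obtain ⟨t, _, rfl⟩ := Finset.mem_image.mp hn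
  have h2 : ((Nat.gcd (g t) M : ℕ) : ℤ) ∣ x + M * t - f (g t) :=
    (Int.natCast_dvd_natCast.mpr (Nat.gcd_dvd_left _ _)).trans (hg t)
  have h3 : ((Nat.gcd (g t) M : ℕ) : ℤ) ∣ M * t :=
    Dvd.dvd.mul_right (Int.natCast_dvd_natCast.mpr (Nat.gcd_dvd_right _ _)) _
  have h4 := Int.dvd_sub h2 h3
  have e : x + M * t - f (g t) - M * t = x - f (g t) := by ring
  rwa [e] at h4

theorem drop_moduli (f : ℕ → ℤ) (S T U : Finset ℕ) (p M : ℕ) (hU : U = S ∪ T)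
    (hcov : ∀ x, CoveredByModuli f U x)
    (hS : ∀ n ∈ S, n ∣ M) (hT : ∀ n ∈ T, 0 < n ∧ p ∣ n / Nat.gcd n M) (hc : T.card < p) :
    ∀ x, CoveredByModuli f S x := by
  subst hU
  intro x
  by_contra hx
  have := (key_shift f S T (fun _ => False) p M (fun _ _ h => h) (fun x => Or.inr (hcov x)) hS hT x
    (by simpa using hx)).1
  omega

theorem three_classes {a b c r s t u : ℤ}
    (h : ∀ z, z = r ∨ z = s ∨ z = t ∨ z = u → (12 ∣ z - a ∨ 12 ∣ z - b) ∨ 12 ∣ z - c)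
    (h1 : ¬ 12 ∣ r - s) (h2 : ¬ 12 ∣ r - t) (h3 : ¬ 12 ∣ r - u) (h4 : ¬ 12 ∣ s - t)
    (h5 : ¬ 12 ∣ s - u) (h6 : ¬ 12 ∣ t - u) : False := by
  have hr := h r (by simp)
  have hs := h s (by simp)
  have ht := h t (by simp)
  have hu := h u (by simp)
  clear h
  rcases hr with (hr | hr) | hr <;> rcases hs with (hs | hs) | hs <;> try omega

theorem final_step (a3 a4 a6 a b c : ℤ)
    (h : ∀ z : ℤ, ((12 ∣ z - a ∨ 12 ∣ z - b) ∨ 12 ∣ z - c) ∨ 3 ∣ z - a3 ∨ 4 ∣ z - a4 ∨ 6 ∣ z - a6) :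
    False := by
  obtain ⟨y, hy3, hy4⟩ : ∃ y : ℤ, 3 ∣ y - a3 ∧ 4 ∣ y - a4 :=
    ⟨4 * a3 - 3 * a4, by omega, by omega⟩
  have h' : ∀ z : ℤ, ¬ 3 ∣ z - y → ¬ 4 ∣ z - y → ¬ 6 ∣ z - a6 →
      (12 ∣ z - a ∨ 12 ∣ z - b) ∨ 12 ∣ z - c := by
    intro z h1 h2 h3
    rcases h z with h | h | h | h
    · exact h
    all_goals omega
  clear h
  have hc : 6 ∣ y + 1 - a6 ∨ 6 ∣ y + 5 - a6 ∨ (¬ 6 ∣ y + 1 - a6 ∧ ¬ 6 ∣ y + 5 - a6) := by tauto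
  rcases hc with hc | hc | ⟨hc, hd⟩
  · apply three_classes (a := a) (b := b) (c := c) (r := y + 2) (s := y + 5) (t := y + 10)
      (u := y + 11) <;> try omega
    rintro z (rfl | rfl | rfl | rfl) <;> apply h' <;> omega
  · apply three_classes (a := a) (b := b) (c := c) (r := y + 2) (s := y + 1) (t := y + 10)
      (u := y + 7) <;> try omega
    rintro z (rfl | rfl | rfl | rfl) <;> apply h' <;> omega
  · apply three_classes (a := a) (b := b) (c := c) (r := y + 1) (s := y + 5) (t := y + 7)
      (u := y + 11) <;> try omega
    rintro z (rfl | rfl | rfl | rfl) <;> apply h' <;> omega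

theorem no_cover (f : ℕ → ℤ) (h0 : ∀ x, CoveredByModuli f (Finset.Icc 3 35) x) : False := by
  have h1 := drop_moduli f {3, 4, 5, 6, 7, 8, 9, 10, 11, 12, 13, 14, 15, 16, 17, 18, 19, 20, 21, 22, 23, 24, 25, 26, 27, 28, 29, 30, 32, 33, 34, 35}
    {31} _ 31 4658179125600 (by decide) h0
    (by decide) (by decide) (by decide)
  have h2 := drop_moduli f {3, 4, 5, 6, 7, 8, 9, 10, 11, 12, 13, 14, 15, 16, 17, 18, 19, 20, 21, 22, 23, 24, 25, 26, 27, 28, 30, 32, 33, 34, 35}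
    {29} _ 29 160626866400 (by decide) h1
    (by decide) (by decide) (by decide)
  have h3 := drop_moduli f {3, 4, 5, 6, 7, 8, 9, 10, 11, 12, 13, 14, 15, 16, 17, 18, 19, 20, 21, 22, 24, 25, 26, 27, 28, 30, 32, 33, 34, 35}
    {23} _ 23 6983776800 (by decide) h2
    (by decide) (by decide) (by decide)
  have h4 := drop_moduli f {3, 4, 5, 6, 7, 8, 9, 10, 11, 12, 13, 14, 15, 16, 17, 18, 20, 21, 22, 24, 25, 26, 27, 28, 30, 32, 33, 34, 35}
    {19} _ 19 367567200 (by decide) h3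
    (by decide) (by decide) (by decide)
  have h5 := drop_moduli f {3, 4, 5, 6, 7, 8, 9, 10, 11, 12, 13, 14, 15, 16, 18, 20, 21, 22, 24, 25, 26, 27, 28, 30, 32, 33, 35}
    {17, 34} _ 17 21621600 (by decide) h4
    (by decide) (by decide) (by decide)
  have h6 := drop_moduli f {3, 4, 5, 6, 7, 8, 9, 10, 11, 12, 14, 15, 16, 18, 20, 21, 22, 24, 25, 27, 28, 30, 32, 33, 35}
    {13, 26} _ 13 1663200 (by decide) h5
    (by decide) (by decide) (by decide)
  have h7 := drop_moduli f {3, 4, 5, 6, 7, 8, 9, 10, 12, 14, 15, 16, 18, 20, 21, 24, 25, 27, 28, 30, 32, 35}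
    {11, 22, 33} _ 11 151200 (by decide) h6
    (by decide) (by decide) (by decide)
  have h8 := drop_moduli f {3, 4, 5, 6, 8, 9, 10, 12, 15, 16, 18, 20, 24, 25, 27, 30, 32}
    {7, 14, 21, 28, 35} _ 7 21600 (by decide) h7
    (by decide) (by decide) (by decide)
  have h9 := drop_moduli f {3, 4, 5, 6, 8, 9, 10, 12, 15, 16, 18, 20, 24, 27, 30, 32}
    {25} _ 5 4320 (by decide) h8
    (by decide) (by decide) (by decide)
  have h10 := drop_moduli f {3, 4, 5, 6, 8, 9, 10, 12, 15, 16, 18, 20, 24, 27, 30}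
    {32} _ 2 2160 (by decide) h9
    (by decide) (by decide) (by decide)
  have h11 := drop_moduli f {3, 4, 5, 6, 8, 9, 10, 12, 15, 18, 20, 24, 27, 30}
    {16} _ 2 1080 (by decide) h10
    (by decide) (by decide) (by decide)
  have h12 := drop_moduli f {3, 4, 5, 6, 8, 9, 10, 12, 15, 18, 20, 24, 30}
    {27} _ 3 360 (by decide) h11
    (by decide) (by decide) (by decide)
  have h13 := drop_moduli f {3, 4, 5, 6, 8, 10, 12, 15, 20, 24, 30}
    {9, 18} _ 3 120 (by decide) h12
    (by decide) (by decide) (by decide)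
  -- the five multiples of 5 act as one class modulo 12
  obtain ⟨e, he⟩ : ∃ e : ℤ, ∀ x, 12 ∣ x - e ∨ CoveredByModuli f {3, 4, 6, 8, 12, 24} x := by
    by_cases hx : ∀ x, CoveredByModuli f {3, 4, 6, 8, 12, 24} x
    · exact ⟨0, fun x => Or.inr (hx x)⟩
    push Not at hx
    obtain ⟨e, he⟩ := hx
    have hk : ∀ x, ¬ CoveredByModuli f {3, 4, 6, 8, 12, 24} x → 4 ∣ x - f 20 ∧ 6 ∣ x - f 30 := by
      intro x hx
      have := (key_shift f {3, 4, 6, 8, 12, 24} {5, 10, 15, 20, 30} (fun _ => False) 5 24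
        (fun _ _ h => h)
        (fun x => Or.inr ((by decide : ({3, 4, 5, 6, 8, 10, 12, 15, 20, 24, 30} : Finset ℕ) =
          {3, 4, 6, 8, 12, 24} ∪ {5, 10, 15, 20, 30}) ▸ h13 x))
        (by decide) (by decide) x (by simpa using hx)).2 (by decide)
      exact ⟨this 20 (by decide), this 30 (by decide)⟩
    refine ⟨e, fun x => ?_⟩
    by_cases hx : CoveredByModuli f {3, 4, 6, 8, 12, 24} x
    · exact Or.inr hx
    · left
      have h1 := hk x hx
      have h2 := hk e he
      omega
  -- the moduli 8 and 24 act as one class modulo 12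
  have h24 : ∀ x, (12 ∣ x - e ∨ CoveredByModuli f {3, 4, 6, 12} x) ∨ 12 ∣ x - f 24 := by
    intro x
    by_cases hx : 12 ∣ x - e ∨ CoveredByModuli f {3, 4, 6, 12} x
    · exact Or.inl hx
    · right
      exact (key_shift f {3, 4, 6, 12} {8, 24} (fun x => 12 ∣ x - e) 2 12
        (fun x t h => by push_cast at h; omega)
        (fun x => (by decide : ({3, 4, 6, 8, 12, 24} : Finset ℕ) =
          {3, 4, 6, 12} ∪ {8, 24}) ▸ he x)
        (by decide) (by decide) x hx).2 (by decide) 24 (by decide)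
  apply final_step (f 3) (f 4) (f 6) (f 12) e (f 24)
  intro z
  rcases h24 z with (h | ⟨n, hn, h⟩) | h
  · tauto
  · simp only [Finset.mem_insert, Finset.mem_singleton] at hn
    rcases hn with rfl | rfl | rfl | rfl <;> push_cast at h <;> tauto
  · tauto

/-- If a distinct covering system has least modulus equal to `3`, then its largest
modulus is at least `36`. -/
theorem min_modulus_three_implies_max_ge_36 (C : Finset (ℤ × ℕ))
    (hC : IsDistinctCoveringSystem C)
    (hmin : ∀ c ∈ C, 3 ≤ c.2) (h3 : ∃ c ∈ C, c.2 = 3) :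
    ∃ c ∈ C, 36 ≤ c.2 := by
  by_contra hcon
  push Not at hcon
  classical
  have hf : ∀ n : ℕ, ∃ a : ℤ, ∀ c ∈ C, c.2 = n → c.1 = a := by
    intro n
    by_cases h : ∃ c ∈ C, c.2 = n
    · obtain ⟨c, hc, hn⟩ := h
      refine ⟨c.1, fun c' hc' hn' => ?_⟩
      by_contra hne
      exact hC.2.2 c' hc' c hc (fun h => hne (by rw [h])) (by rw [hn, hn'])
    · exact ⟨0, fun c hc hn => absurd ⟨c, hc, hn⟩ h⟩
  choose f hf using hf
  apply no_cover f
  intro x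
  obtain ⟨c, hc, hx⟩ := hC.1.2 x
  refine ⟨c.2, Finset.mem_Icc.mpr ⟨hmin c hc, by have := hcon c hc; omega⟩, ?_⟩
  rw [← hf c.2 c hc rfl]
  exact hx.symm.dvd
end
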